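/- arXiv:1209.6096 — 3 statements merged into one kernel-verified Lean document; each statement's English description precedes it below -/
import Mathlib

section
/- Let W ⊆ ℂ be a bounded, open, connected, simply connected set and let f : 𝔻 → W be a holomorphic bijection from the open unit disk 𝔻 = {z ∈ ℂ : |z| < 1} onto W. Then f admits a continuous extension F : closure(𝔻) → ℂ (i.e., a continuous F with F(z) = f(z) for all z ∈ 𝔻) if and only if the boundary ∂W, with its subspace topology from ℂ, is locally connected. -/
open Set Filter Topology MeasureTheory Metric

/-- The function `φ` admits a continuous logarithm on `K`. -/
def HasContinuousLogOn (φ : ℂ → ℂ) (K : Set ℂ) : Prop :=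
  ∃ L : ℂ → ℂ, ContinuousOn L K ∧ ∀ z ∈ K, Complex.exp (L z) = φ z

theorem HasContinuousLogOn.mul {φ ψ : ℂ → ℂ} {K : Set ℂ} (hφ : HasContinuousLogOn φ K)
    (hψ : HasContinuousLogOn ψ K) : HasContinuousLogOn (fun z => φ z * ψ z) K := by
  obtain ⟨L, hL, hLe⟩ := hφ
  obtain ⟨M, hM, hMe⟩ := hψ
  exact ⟨fun z => L z + M z, hL.add hM, fun z hz => by rw [Complex.exp_add, hLe z hz, hMe z hz]⟩

theorem HasContinuousLogOn.inv {φ : ℂ → ℂ} {K : Set ℂ} (hφ : HasContinuousLogOn φ K) :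
    HasContinuousLogOn (fun z => (φ z)⁻¹) K := by
  obtain ⟨L, hL, hLe⟩ := hφ
  exact ⟨fun z => -L z, hL.neg, fun z hz => by rw [Complex.exp_neg, hLe z hz]⟩

theorem HasContinuousLogOn.congr {φ ψ : ℂ → ℂ} {K : Set ℂ} (hφ : HasContinuousLogOn φ K)
    (h : ∀ z ∈ K, φ z = ψ z) : HasContinuousLogOn ψ K := by
  obtain ⟨L, hL, hLe⟩ := hφ
  exact ⟨L, hL, fun z hz => by rw [hLe z hz, h z hz]⟩

theorem HasContinuousLogOn.mono {φ : ℂ → ℂ} {K K' : Set ℂ} (hφ : HasContinuousLogOn φ K)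
    (h : K' ⊆ K) : HasContinuousLogOn φ K' := by
  obtain ⟨L, hL, hLe⟩ := hφ
  exact ⟨L, hL.mono h, fun z hz => hLe z (h hz)⟩

theorem hasContinuousLogOn_of_slitPlane {φ : ℂ → ℂ} {K : Set ℂ} (hφ : ContinuousOn φ K)
    (h : ∀ z ∈ K, φ z ∈ Complex.slitPlane) : HasContinuousLogOn φ K :=
  ⟨fun z => Complex.log (φ z), hφ.clog h,
    fun z hz => Complex.exp_log (Complex.slitPlane_ne_zero (h z hz))⟩

theorem hasContinuousLogOn_const {c : ℂ} (hc : c ≠ 0) (K : Set ℂ) :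
    HasContinuousLogOn (fun _ => c) K :=
  ⟨fun _ => Complex.log c, continuousOn_const, fun _ _ => Complex.exp_log hc⟩

theorem mem_slitPlane_of_norm_sub_one_lt {z : ℂ} (h : ‖z - 1‖ < 1) : z ∈ Complex.slitPlane := by
  have := Complex.mem_slitPlane_of_norm_lt_one h
  simpa using this

/-- The function `z - w` has a continuous logarithm on every closed ball not containing `w`. -/
theorem hasContinuousLogOn_sub_closedBall {a w : ℂ} {ε : ℝ} (h : ε < dist w a) :
    HasContinuousLogOn (fun z => z - w) (closedBall a ε) := by
  by_cases hε : 0 ≤ ε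
  swap
  · rw [closedBall_eq_empty.2 (not_le.1 hε)]
    exact ⟨0, by simp, by simp⟩
  have hne : a - w ≠ 0 := by
    rw [sub_ne_zero]; rintro rfl; simp at h; linarith
  refine ((hasContinuousLogOn_const hne _).mul (hasContinuousLogOn_of_slitPlane
    (φ := fun z => (z - w) / (a - w)) (by fun_prop) fun z hz => ?_)).congr
    fun z _ => by field_simp
  apply mem_slitPlane_of_norm_sub_one_lt
  have : (z - w) / (a - w) - 1 = (z - a) / (a - w) := by field_simp; ring
  rw [this, norm_div, div_lt_one (norm_pos_iff.2 hne), ← dist_eq_norm, ← dist_eq_norm,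
    dist_comm a w]
  exact lt_of_le_of_lt (mem_closedBall.1 hz) h

/-- Points of a preconnected set disjoint from a closed set `K` are not separated by `K`. -/
theorem hasContinuousLogOn_div_of_isPreconnected {K W : Set ℂ} (hK : IsClosed K)
    (hW : IsPreconnected W) (hd : Disjoint W K) {u v : ℂ} (hu : u ∈ W) (hv : v ∈ W) :
    HasContinuousLogOn (fun z => (z - u) / (z - v)) K := by
  have hne : ∀ x ∈ W, ∀ z ∈ K, z - x ≠ 0 := fun x hx z hz => by
    rw [sub_ne_zero]; rintro rfl; exact hd.le_bot ⟨hx, hz⟩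
  refine hW.induction₂ (fun u v => HasContinuousLogOn (fun z => (z - u) / (z - v)) K)
    (fun x hx => ?_) (fun x y z hx hy hz h1 h2 => ?_) (fun x y hx hy h => ?_) hu hv
  · obtain ⟨δ, hδ, hball⟩ := Metric.isOpen_iff.1 hK.isOpen_compl x
      (fun h => hd.le_bot ⟨hx, h⟩)
    filter_upwards [self_mem_nhdsWithin, mem_nhdsWithin_of_mem_nhds (ball_mem_nhds x hδ)]
      with y hy hyx
    have key : HasContinuousLogOn (fun z => (z - y) / (z - x)) K := by
      refine hasContinuousLogOn_of_slitPlane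
        (ContinuousOn.div (by fun_prop) (by fun_prop) (hne x hx)) fun z hz => ?_
      apply mem_slitPlane_of_norm_sub_one_lt
      have hzx := hne x hx z hz
      have : (z - y) / (z - x) - 1 = (x - y) / (z - x) := by field_simp; ring
      rw [this, norm_div, div_lt_one (norm_pos_iff.2 hzx), ← dist_eq_norm, ← dist_eq_norm]
      rw [mem_ball, dist_comm] at hyx
      refine hyx.trans_le (not_lt.1 fun h => hball (mem_ball.2 h) hz)
    exact key.inv.congr fun z _ => by rw [inv_div]
  · refine (h1.mul h2).congr fun w hw => ?_
    have := hne y hy w hw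
    have := hne z hz w hw
    field_simp
  · exact h.inv.congr fun z _ => by rw [inv_div]

theorem IsPreconnected.eq_of_exp_eq_one {X : Type*} [TopologicalSpace X] {S : Set X}
    (hS : IsPreconnected S) {f : X → ℂ} (hf : ContinuousOn f S)
    (hexp : ∀ x ∈ S, Complex.exp (f x) = 1) {x y : X} (hx : x ∈ S) (hy : y ∈ S) : f x = f y := by
  refine hS.constant_of_mapsTo
    (T := (AddSubgroup.zmultiples (2 * Real.pi * Complex.I) : Set ℂ))
    (isDiscrete_iff_discreteTopology.2
      (NormedSpace.discreteTopology_zmultiples (2 * Real.pi * Complex.I))) hf (fun z hz => ?_) hx hy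
  obtain ⟨n, hn⟩ := Complex.exp_eq_one_iff.1 (hexp z hz)
  exact ⟨n, by simp [hn]⟩

/-- Continuous logarithms on two closed sets with preconnected intersection can be glued. -/
theorem HasContinuousLogOn.union {φ : ℂ → ℂ} {K₁ K₂ : Set ℂ} (h₁ : HasContinuousLogOn φ K₁)
    (h₂ : HasContinuousLogOn φ K₂) (hK₁ : IsClosed K₁) (hK₂ : IsClosed K₂)
    (hc : IsPreconnected (K₁ ∩ K₂)) : HasContinuousLogOn φ (K₁ ∪ K₂) := by
  obtain ⟨L, hL, hLe⟩ := h₁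
  obtain ⟨M, hM, hMe⟩ := h₂
  obtain ⟨c, hc1, hce⟩ : ∃ c : ℂ, Complex.exp c = 1 ∧ ∀ z ∈ K₁ ∩ K₂, L z = M z + c := by
    rcases (K₁ ∩ K₂).eq_empty_or_nonempty with he | ⟨p, hp⟩
    · exact ⟨0, by simp, by simp [he]⟩
    have hexp : ∀ z ∈ K₁ ∩ K₂, Complex.exp (L z - M z) = 1 := fun z hz => by
      rw [Complex.exp_sub, hLe z hz.1, hMe z hz.2, div_self]
      rw [← hLe z hz.1]; exact Complex.exp_ne_zero _
    refine ⟨L p - M p, hexp p hp, fun z hz => ?_⟩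
    have := hc.eq_of_exp_eq_one (f := fun z => L z - M z)
      ((hL.mono inter_subset_left).sub (hM.mono inter_subset_right)) hexp hz hp
    linear_combination this
  classical
  refine ⟨K₁.piecewise L (fun z => M z + c), ContinuousOn.union_of_isClosed ?_ ?_ hK₁ hK₂, ?_⟩
  · exact hL.congr fun z hz => piecewise_eq_of_mem _ _ _ hz
  · refine (hM.add (continuousOn_const (c := c))).congr fun z hz => ?_
    by_cases h : z ∈ K₁
    · rw [piecewise_eq_of_mem _ _ _ h, hce z ⟨h, hz⟩]; rfl
    · rw [piecewise_eq_of_notMem _ _ _ h]; rfl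
  · intro z hz
    by_cases h : z ∈ K₁
    · rw [piecewise_eq_of_mem _ _ _ h, hLe z h]
    · rw [piecewise_eq_of_notMem _ _ _ h, Complex.exp_add, hc1, mul_one,
        hMe z (hz.resolve_left h)]

theorem Continuous.hasContinuousLogOn_univ {h : ℂ → ℂ} (hc : Continuous h) (h0 : ∀ z, h z ≠ 0) :
    HasContinuousLogOn h univ := by
  obtain ⟨F, ⟨-, hF⟩, -⟩ := Complex.isCoveringMap_exp.existsUnique_continuousMap_lifts
    (A := ℂ) ⟨fun z => (⟨h z, h0 z⟩ : {z : ℂ // z ≠ 0}), by fun_prop⟩ 0 (Complex.log (h 0))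
    (Subtype.ext (Complex.exp_log (h0 0)))
  exact ⟨F, F.continuous.continuousOn, fun z _ => congrArg Subtype.val (congrFun hF z)⟩

theorem not_hasContinuousLogOn_id_sphere {R : ℝ} (hR : 0 < R) :
    ¬ HasContinuousLogOn id (sphere 0 R) := by
  rintro ⟨L, hL, hLe⟩
  have hmem : ∀ t : ℝ, (R : ℂ) * Complex.exp (t * Complex.I) ∈ sphere (0 : ℂ) R := fun t => by
    simp [Complex.norm_exp_ofReal_mul_I, abs_of_pos hR]
  have hcont : Continuous fun t : ℝ => L (R * Complex.exp (t * Complex.I)) - t * Complex.I :=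
    (hL.comp_continuous (by fun_prop) hmem).sub (by fun_prop)
  have hR' : (R : ℂ) ≠ 0 := by exact_mod_cast hR.ne'
  have hconst := isPreconnected_univ.eq_of_exp_eq_one
    (f := fun t : ℝ => L (R * Complex.exp (t * Complex.I)) - t * Complex.I - Complex.log R)
    (hcont.sub continuous_const).continuousOn (fun t _ => by
      rw [Complex.exp_sub, Complex.exp_sub, hLe _ (hmem t), Complex.exp_log hR']
      simp [hR']) (mem_univ 0) (mem_univ (2 * Real.pi))
  have : Complex.exp ((2 * Real.pi : ℝ) * Complex.I) = 1 := by
    push_cast; exact Complex.exp_two_pi_mul_I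
  simp only [this] at hconst
  have h2 : (2 * Real.pi * Complex.I : ℂ) = 0 := by
    simp at hconst
    linear_combination hconst
  exact Complex.two_pi_I_ne_zero h2

/-- If the frontier of a bounded open set `U` lies in a closed set `K`, then `K` separates
points of `U` from points outside of `U`. -/
theorem not_hasContinuousLogOn_div {U K : Set ℂ} (hUb : Bornology.IsBounded U)
    (hK : IsClosed K) (hUK : frontier U ⊆ K) {w v : ℂ} (hw : w ∈ U) (hv : v ∉ U)
    (hvK : v ∉ K) :
    ¬ HasContinuousLogOn (fun z => (z - w) / (z - v)) K := by
  rintro ⟨L, hL, hLe⟩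
  obtain ⟨M, hM⟩ := ContinuousMap.exists_restrict_eq hK ⟨K.domRestrict L, hL.domRestrict⟩
  have hML : ∀ z ∈ K, M z = L z := fun z hz => congrArg (fun f => f ⟨z, hz⟩) hM
  classical
  set h : ℂ → ℂ := U.piecewise (fun z => (z - v) * Complex.exp (M z)) (fun z => z - w) with hh
  have hcont : Continuous h := by
    refine Continuous.piecewise (fun z hz => ?_) (by fun_prop) (by fun_prop)
    have hzK := hUK hz
    have : z - v ≠ 0 := by rw [sub_ne_zero]; rintro rfl; exact hvK hzK
    rw [hML z hzK, hLe z hzK]; field_simp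
  have hne : ∀ z, h z ≠ 0 := fun z => by
    by_cases hz : z ∈ U
    · rw [hh, piecewise_eq_of_mem _ _ _ hz]
      refine mul_ne_zero ?_ (Complex.exp_ne_zero _)
      rw [sub_ne_zero]; rintro rfl; exact hv hz
    · rw [hh, piecewise_eq_of_notMem _ _ _ hz, sub_ne_zero]; rintro rfl; exact hz hw
  have hlog := hcont.hasContinuousLogOn_univ hne
  obtain ⟨R, hR⟩ := hUb.subset_ball w
  have hR0 : 0 < R := dist_nonneg.trans_lt (mem_ball.1 (hR hw))
  obtain ⟨N, hN, hNe⟩ := hlog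
  apply not_hasContinuousLogOn_id_sphere hR0
  refine ⟨fun z => N (z + w), (hN.comp_continuous (by fun_prop) fun _ => mem_univ _).continuousOn,
    fun z hz => ?_⟩
  have hz' : z + w ∉ U := fun h => by
    have := hR h
    rw [mem_ball, dist_eq_norm] at this
    simp at this hz
    linarith
  rw [hNe _ (mem_univ _), hh, piecewise_eq_of_notMem _ _ _ hz']
  simp
theorem lintegral_ofReal_inv_Ioo {δ : ℝ} (hδ : 0 < δ) :
    ∫⁻ r in Ioo 0 δ, ENNReal.ofReal r⁻¹ = ⊤ := by
  by_contra hne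
  have hIoo : IntegrableOn (fun r : ℝ => r⁻¹) (Ioo 0 δ) := by
    refine ⟨by fun_prop, ?_⟩
    rw [hasFiniteIntegral_iff_ofReal]
    · exact lt_top_iff_ne_top.2 hne
    · filter_upwards [ae_restrict_mem measurableSet_Ioo] with r hr
      exact inv_nonneg.2 hr.1.le
  have := (intervalIntegrable_iff_integrableOn_Ioo_of_le hδ.le).2 hIoo
  rw [intervalIntegrable_inv_iff] at this
  simp [hδ.ne, hδ.le] at this

theorem ENNReal.le_add_inv_mul_sq (a : ENNReal) {t : ENNReal} (h0 : t ≠ 0) (ht : t ≠ ⊤) :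
    a ≤ t + t⁻¹ * a ^ 2 := by
  rcases le_total a t with h | h
  · exact h.trans le_self_add
  · calc a = t⁻¹ * (t * a) := by rw [← mul_assoc, ENNReal.inv_mul_cancel h0 ht, one_mul]
      _ ≤ t⁻¹ * a ^ 2 := by rw [sq]; gcongr
      _ ≤ _ := le_add_self

theorem Complex.polarCoord_symm_eq_circleMap (p : ℝ × ℝ) :
    Complex.polarCoord.symm p = circleMap 0 p.1 p.2 := by
  rw [Complex.polarCoord_symm_apply, circleMap_zero, Complex.exp_mul_I]
  simp

/-- The **length-area principle**: a square integrable density has small integral over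
arbitrarily small circles centered at the origin. -/
theorem exists_lintegral_circleMap_lt {φ : ℂ → ENNReal} (hφ : Measurable φ)
    (hfin : ∫⁻ z, φ z ^ 2 ≠ ⊤) {ε δ : ℝ} (hε : 0 < ε) (hδ : 0 < δ) :
    ∃ r ∈ Ioo 0 δ, ∫⁻ θ in Ioo (-Real.pi) Real.pi,
      ENNReal.ofReal r * φ (circleMap 0 r θ) < ENNReal.ofReal ε := by
  by_contra! hcon
  apply hfin
  set t : ℝ := ε / (4 * Real.pi) with ht
  have ht0 : 0 < t := by positivity
  have hT0 : ENNReal.ofReal t ≠ 0 := by simpa using ht0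
  have hmeas : Measurable fun p : ℝ × ℝ => φ (circleMap 0 p.1 p.2) :=
    hφ.comp (by unfold circleMap; fun_prop)
  have hmeas' : ∀ r : ℝ, Measurable fun θ : ℝ => φ (circleMap 0 r θ) := fun r =>
    hmeas.comp (measurable_const.prodMk measurable_id)
  have hinner : ∀ r ∈ Ioo 0 δ, ENNReal.ofReal (t * (ε / 2)) * ENNReal.ofReal r⁻¹ ≤
      ∫⁻ θ in Ioo (-Real.pi) Real.pi, ENNReal.ofReal r * φ (circleMap 0 r θ) ^ 2 := by
    intro r hr
    set R := ENNReal.ofReal r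
    have hR0 : R ≠ 0 := by simpa [R] using hr.1
    set J := ∫⁻ θ in Ioo (-Real.pi) Real.pi, R * φ (circleMap 0 r θ) ^ 2
    have h1 : ENNReal.ofReal ε ≤ ENNReal.ofReal (ε / 2) + (ENNReal.ofReal t)⁻¹ * (R * J) := by
      calc ENNReal.ofReal ε ≤ ∫⁻ θ in Ioo (-Real.pi) Real.pi, R * φ (circleMap 0 r θ) := hcon r hr
        _ ≤ ∫⁻ θ in Ioo (-Real.pi) Real.pi, (ENNReal.ofReal t +
            (ENNReal.ofReal t)⁻¹ * (R * (R * φ (circleMap 0 r θ) ^ 2))) := by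
          refine lintegral_mono fun θ => ?_
          refine (ENNReal.le_add_inv_mul_sq _ hT0 ENNReal.ofReal_ne_top).trans_eq ?_
          ring
        _ = _ := by
          rw [lintegral_add_left (by fun_prop), lintegral_const_mul _ (by fun_prop),
            lintegral_const_mul _ (by fun_prop), lintegral_const, Measure.restrict_apply_univ,
            Real.volume_Ioo, ← ENNReal.ofReal_mul ht0.le]
          congr 2
          rw [ht]; field_simp; ring
    have h2 : ENNReal.ofReal (ε / 2) ≤ (ENNReal.ofReal t)⁻¹ * (R * J) := by
      rw [show ENNReal.ofReal ε = ENNReal.ofReal (ε / 2) + ENNReal.ofReal (ε / 2) by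
        rw [← ENNReal.ofReal_add (by positivity) (by positivity)]; congr 1; ring] at h1
      exact (ENNReal.add_le_add_iff_left ENNReal.ofReal_ne_top).1 h1
    rw [ENNReal.ofReal_mul ht0.le, ENNReal.ofReal_inv_of_pos hr.1]
    calc ENNReal.ofReal t * ENNReal.ofReal (ε / 2) * R⁻¹
        ≤ ENNReal.ofReal t * ((ENNReal.ofReal t)⁻¹ * (R * J)) * R⁻¹ := by gcongr
      _ = (ENNReal.ofReal t * (ENNReal.ofReal t)⁻¹) * (R * R⁻¹) * J := by ring
      _ = J := by
        rw [ENNReal.mul_inv_cancel hT0 ENNReal.ofReal_ne_top,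
          ENNReal.mul_inv_cancel hR0 ENNReal.ofReal_ne_top, one_mul, one_mul]
  have hsub : ∫⁻ r in Ioo 0 δ, ENNReal.ofReal (t * (ε / 2)) * ENNReal.ofReal r⁻¹ ≤
      ∫⁻ z, φ z ^ 2 := by
    rw [← Complex.lintegral_comp_polarCoord_symm, polarCoord_target,
      Measure.volume_eq_prod, ← Measure.prod_restrict]
    simp_rw [Complex.polarCoord_symm_eq_circleMap, smul_eq_mul]
    rw [lintegral_prod _ (by fun_prop)]
    exact (setLIntegral_mono' measurableSet_Ioo hinner).trans
      (lintegral_mono_set Ioo_subset_Ioi_self)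
  rw [lintegral_const_mul _ (by fun_prop), lintegral_ofReal_inv_Ioo hδ,
    ENNReal.mul_top (by simp; positivity)] at hsub
  exact top_le_iff.1 hsub

/-- The area formula for injective holomorphic functions. -/
theorem lintegral_enorm_deriv_sq_eq_volume_image {g : ℂ → ℂ} {Ω : Set ℂ} (hΩ : IsOpen Ω)
    (hg : DifferentiableOn ℂ g Ω) (hinj : InjOn g Ω) :
    ∫⁻ z in Ω, ‖deriv g z‖ₑ ^ 2 = volume (g '' Ω) := by
  have hd : ∀ z ∈ Ω, HasFDerivWithinAt g
      ((ContinuousLinearMap.toSpanSingleton ℂ (deriv g z)).restrictScalars ℝ) Ω z := fun z hz =>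
    ((hg.differentiableAt (hΩ.mem_nhds hz)).hasDerivAt.hasFDerivAt.restrictScalars
      ℝ).hasFDerivWithinAt
  rw [← lintegral_abs_det_fderiv_eq_addHaar_image volume hΩ.measurableSet hd hinj]
  congr 1 with z
  have : ((ContinuousLinearMap.toSpanSingleton ℂ (deriv g z)).restrictScalars ℝ).det
      = ‖deriv g z‖ ^ 2 := by
    simp [ContinuousLinearMap.det, LinearMap.det_restrictScalars, Algebra.norm_complex_eq,
      Complex.normSq_eq_norm_sq]
  rw [this, abs_of_nonneg (by positivity), ENNReal.ofReal_pow (norm_nonneg _), ofReal_norm]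

/-- A compact locally connected set is uniformly locally connected. -/
theorem IsCompact.exists_isPreconnected_of_dist_lt {X : Type*} [MetricSpace X] {S : Set X}
    (hS : IsCompact S) [LocallyConnectedSpace S] {ε : ℝ} (hε : 0 < ε) :
    ∃ δ > 0, ∀ a ∈ S, ∀ b ∈ S, dist a b < δ → ∃ B ⊆ S, IsClosed B ∧ IsPreconnected B ∧
      a ∈ B ∧ b ∈ B ∧ B ⊆ closedBall a ε := by
  have : CompactSpace S := isCompact_iff_compactSpace.1 hS
  choose V hVsub hVo hVmem hVc using fun p : S =>
    locallyConnectedSpace_iff_subsets_isOpen_isConnected.1 ‹_› p (ball p (ε / 2))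
      (ball_mem_nhds p (by positivity))
  obtain ⟨δ, hδ, h⟩ := lebesgue_number_lemma_of_metric (isCompact_univ (X := S)) hVo
    (fun p _ => mem_iUnion.2 ⟨p, hVmem p⟩)
  refine ⟨δ, hδ, fun a ha b hb hab => ?_⟩
  obtain ⟨p, hp⟩ := h ⟨a, ha⟩ (mem_univ _)
  have haV := hp (mem_ball_self hδ)
  have hbV : (⟨b, hb⟩ : S) ∈ V p := hp (by rwa [mem_ball, dist_comm])
  refine ⟨Subtype.val '' closure (V p), by simp, ?_, ?_, ⟨_, subset_closure haV, rfl⟩,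
    ⟨_, subset_closure hbV, rfl⟩, ?_⟩
  · exact (isClosed_closure.isCompact.image continuous_subtype_val).isClosed
  · exact (hVc p).isPreconnected.closure.image _ continuous_subtype_val.continuousOn
  · have hcl : closure (V p) ⊆ closedBall p (ε / 2) :=
      closure_minimal ((hVsub p).trans ball_subset_closedBall) isClosed_closedBall
    rintro _ ⟨q, hq, rfl⟩
    have h1 := mem_closedBall.1 (hcl hq)
    have h2 := mem_closedBall'.1 (hcl (subset_closure haV))
    have := dist_triangle q p ⟨a, ha⟩
    rw [mem_closedBall]
    change dist q ⟨a, ha⟩ ≤ ε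
    linarith

section Conformal

variable {g : ℂ → ℂ} {Ω W : Set ℂ}

theorem isOpen_image_of_injOn_holomorphic (hΩ : IsOpen Ω)
    (hg : DifferentiableOn ℂ g Ω) (hinj : InjOn g Ω) {s : Set ℂ} (hsΩ : s ⊆ Ω) (hs : IsOpen s) :
    IsOpen (g '' s) := by
  rw [isOpen_iff_mem_nhds]
  rintro _ ⟨z, hz, rfl⟩
  rcases (hg.analyticAt (hΩ.mem_nhds (hsΩ hz))).eventually_constant_or_nhds_le_map_nhds
    with h | h
  · exfalso
    have h1 : ∀ᶠ x in 𝓝[≠] z, x = z := by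
      filter_upwards [h.filter_mono nhdsWithin_le_nhds,
        mem_nhdsWithin_of_mem_nhds (hΩ.mem_nhds (hsΩ hz))] with x hx hxΩ
      exact hinj hxΩ (hsΩ hz) hx
    obtain ⟨x, hx, hx'⟩ := (h1.and self_mem_nhdsWithin).exists
    exact hx' hx
  · exact h (image_mem_map (hs.mem_nhds hz))

/-- The inverse of an injective holomorphic function is continuous. -/
theorem tendsto_of_tendsto_comp_holomorphic (hΩ : IsOpen Ω)
    (hg : DifferentiableOn ℂ g Ω) (hinj : InjOn g Ω) {ι : Type*} {l : Filter ι} {u : ι → ℂ}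
    (hu : ∀ᶠ i in l, u i ∈ Ω) {z : ℂ} (hz : z ∈ Ω) (h : Tendsto (g ∘ u) l (𝓝 (g z))) :
    Tendsto u l (𝓝 z) := by
  intro N hN
  obtain ⟨M, hMN, hMo, hzM⟩ := _root_.mem_nhds_iff.1 (inter_mem hN (hΩ.mem_nhds hz))
  have hM := isOpen_image_of_injOn_holomorphic hΩ hg hinj (hMN.trans inter_subset_right) hMo
  have hgu : ∀ᶠ i in l, g (u i) ∈ g '' M := h.eventually (hM.mem_nhds ⟨z, hzM, rfl⟩)
  rw [Filter.mem_map]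
  filter_upwards [hu, hgu] with i hi ⟨y, hy, hyi⟩
  have := hinj (hMN hy).2 hi hyi
  rw [mem_preimage, ← this]
  exact (hMN hy).1

/-- Boundary points correspond to boundary points. -/
theorem mem_frontier_of_tendsto_comp_holomorphic (hΩ : IsOpen Ω) (hWo : IsOpen W)
    (hg : DifferentiableOn ℂ g Ω) (hbij : BijOn g Ω W) {ι : Type*} {l : Filter ι} [l.NeBot]
    {u : ι → ℂ} (hu : ∀ᶠ i in l, u i ∈ Ω) {z w : ℂ} (hz : z ∉ Ω) (huz : Tendsto u l (𝓝 z))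
    (h : Tendsto (g ∘ u) l (𝓝 w)) : w ∈ frontier W := by
  rw [hWo.frontier_eq]
  refine ⟨mem_closure_of_tendsto h (hu.mono fun i hi => hbij.mapsTo hi), fun hw => hz ?_⟩
  obtain ⟨y, hy, rfl⟩ := hbij.surjOn hw
  rwa [tendsto_nhds_unique huz
    (tendsto_of_tendsto_comp_holomorphic hΩ hg hbij.injOn hu hy h)]

end Conformal

theorem circleMap_mem_ball_one_iff {r θ : ℝ} (hr : 0 < r) :
    circleMap 0 r θ ∈ ball (1 : ℂ) 1 ↔ r / 2 < Real.cos θ := by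
  rw [mem_ball, dist_eq_norm, ← sq_lt_one_iff₀ (norm_nonneg _), ← Complex.normSq_eq_norm_sq,
    circleMap_zero, Complex.exp_mul_I, Complex.normSq_apply]
  simp only [Complex.sub_re, Complex.mul_re, Complex.ofReal_re, Complex.add_re,
    Complex.cos_ofReal_re, Complex.I_re, Complex.sub_im, Complex.mul_im, Complex.ofReal_im,
    Complex.add_im, Complex.cos_ofReal_im, Complex.I_im, Complex.sin_ofReal_re,
    Complex.sin_ofReal_im, Complex.one_re, Complex.one_im]
  have := Real.sin_sq_add_cos_sq θ
  constructor
  · intro h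
    have h' : r * (r - 2 * Real.cos θ) < 0 := by
      linear_combination h - r ^ 2 * this
    nlinarith [neg_of_mul_neg_right h' hr.le]
  · intro h
    have h' : r * (r - 2 * Real.cos θ) < 0 := mul_neg_of_pos_of_neg hr (by linarith)
    linear_combination h' + r ^ 2 * this

theorem circleMap_mem_ball_one_iff_abs_lt {r θ : ℝ} (hr : 0 < r) (hr2 : r < 2)
    (hθ : |θ| ≤ Real.pi) :
    circleMap 0 r θ ∈ ball (1 : ℂ) 1 ↔ |θ| < Real.arccos (r / 2) := by
  rw [circleMap_mem_ball_one_iff hr, ← Real.cos_abs θ]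
  nth_rewrite 1 [← Real.cos_arccos (x := r / 2) (by linarith) (by linarith)]
  exact Real.strictAntiOn_cos.lt_iff_gt ⟨Real.arccos_nonneg _, Real.arccos_le_pi _⟩
    ⟨abs_nonneg _, hθ⟩

/-- If the image of a circular crosscut of a disk has length less than `δ`, its closure is
obtained by adding two boundary points at distance less than `δ`. -/
theorem exists_crosscut {g : ℂ → ℂ} {W : Set ℂ} (hWo : IsOpen W)
    (hg : DifferentiableOn ℂ g (ball 1 1)) (hbij : BijOn g (ball 1 1) W) {r δ : ℝ} (hr : 0 < r)
    (hr1 : r < 1) (hδ : ∫⁻ θ in Ioo (-Real.pi) Real.pi, ENNReal.ofReal r *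
      (ball 1 1).indicator (fun z => ‖deriv g z‖ₑ) (circleMap 0 r θ) < ENNReal.ofReal δ) :
    ∃ a ∈ frontier W, ∃ b ∈ frontier W, dist a b < δ ∧ ∃ C : Set ℂ, IsCompact C ∧
      C ⊆ closedBall a δ ∧ g '' (ball 1 1 ∩ sphere 0 r) ⊆ C ∧ a ∈ C ∧ b ∈ C ∧
      C ∩ frontier W ⊆ {a, b} := by
  set Θ := Real.arccos (r / 2) with hΘ
  have hΘ0 : 0 < Θ := Real.arccos_pos.2 (by linarith)
  have hΘπ : Θ ≤ Real.pi := Real.arccos_le_pi _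
  have hmem : ∀ θ : ℝ, |θ| ≤ Real.pi → (circleMap 0 r θ ∈ ball (1 : ℂ) 1 ↔ θ ∈ Ioo (-Θ) Θ) :=
    fun θ hθ => by rw [circleMap_mem_ball_one_iff_abs_lt hr (by linarith) hθ, abs_lt, mem_Ioo]
  have hIπ : ∀ θ ∈ Icc (-Θ) Θ, |θ| ≤ Real.pi := fun θ hθ => (abs_le.2 hθ).trans hΘπ
  set h : ℝ → ℂ := fun θ => g (circleMap 0 r θ) with hh
  set ψ : ℝ → ℂ := (Ioo (-Θ) Θ).indicator (deriv h) with hψ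
  have hder : ∀ θ ∈ Ioo (-Θ) Θ,
      HasDerivAt h (deriv g (circleMap 0 r θ) * (circleMap 0 r θ * Complex.I)) θ := fun θ hθ =>
    ((hg.differentiableAt (isOpen_ball.mem_nhds
      ((hmem θ (hIπ θ (Ioo_subset_Icc_self hθ))).2 hθ))).hasDerivAt).comp θ
      (hasDerivAt_circleMap 0 r θ)
  have hψmeas : Measurable ψ := (measurable_deriv h).indicator measurableSet_Ioo
  have hψlint : ∫⁻ θ, ‖ψ θ‖ₑ < ENNReal.ofReal δ := by
    refine lt_of_le_of_lt ?_ hδ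
    rw [← lintegral_indicator measurableSet_Ioo]
    refine lintegral_mono fun θ => ?_
    by_cases hθ : θ ∈ Ioo (-Θ) Θ
    · have hθπ : θ ∈ Ioo (-Real.pi) Real.pi := ⟨by linarith [hθ.1], by linarith [hθ.2]⟩
      rw [hψ, indicator_of_mem hθ, indicator_of_mem hθπ,
        indicator_of_mem ((hmem θ (hIπ θ (Ioo_subset_Icc_self hθ))).2 hθ), (hder θ hθ).deriv,
        enorm_mul, enorm_mul, ← ofReal_norm (circleMap 0 r θ), norm_circleMap_zero,
        abs_of_pos hr, ← ofReal_norm Complex.I, Complex.norm_I, ENNReal.ofReal_one, mul_one,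
        mul_comm]
    · simp [hψ, indicator_of_notMem hθ]
  have hψint : Integrable ψ := ⟨hψmeas.aestronglyMeasurable, hψlint.trans_le le_top⟩
  have hδ0 : 0 < δ := by
    by_contra hneg
    rw [ENNReal.ofReal_of_nonpos (not_lt.1 hneg)] at hψlint
    exact not_lt_zero hψlint
  have hψnorm : ∫ θ, ‖ψ θ‖ < δ := by
    rw [integral_norm_eq_lintegral_enorm hψmeas.aestronglyMeasurable]
    exact (ENNReal.lt_ofReal_iff_toReal_lt (hψlint.trans_le le_top).ne).1 hψlint
  set G : ℝ → ℂ := fun θ => h 0 + ∫ t in (0 : ℝ)..θ, ψ t with hG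
  have hGcont : Continuous G :=
    continuous_const.add (intervalIntegral.continuous_primitive
      (fun _ _ => hψint.intervalIntegrable) 0)
  have hGh : ∀ θ ∈ Ioo (-Θ) Θ, G θ = h θ := fun θ hθ => by
    have hsub : uIcc 0 θ ⊆ Ioo (-Θ) Θ := ordConnected_Ioo.uIcc_subset ⟨by linarith, hΘ0⟩ hθ
    have : ∫ t in (0 : ℝ)..θ, ψ t = h θ - h 0 := by
      refine intervalIntegral.integral_eq_sub_of_hasDerivAt (fun t ht => ?_)
        hψint.intervalIntegrable
      rw [hψ, indicator_of_mem (hsub ht), (hder t (hsub ht)).deriv]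
      exact hder t (hsub ht)
    rw [hG]; simp [this]
  have hGdist : ∀ x y, dist (G x) (G y) < δ := fun x y => by
    have : G x - G y = ∫ t in y..x, ψ t := by
      rw [hG]
      simp only [add_sub_add_left_eq_sub]
      exact intervalIntegral.integral_interval_sub_left hψint.intervalIntegrable
        hψint.intervalIntegrable
    rw [dist_eq_norm, this]
    refine lt_of_le_of_lt (intervalIntegral.norm_integral_le_integral_norm_uIoc) ?_
    exact (setIntegral_le_integral hψint.norm (ae_of_all _ fun _ => norm_nonneg _)).trans_lt hψnorm
  have hend : ∀ t ∈ Icc (-Θ) Θ, t ∉ Ioo (-Θ) Θ → G t ∈ frontier W := fun t ht ht' => by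
    have hcl : t ∈ closure (Ioo (-Θ) Θ) := by rwa [closure_Ioo (by linarith)]
    have : (𝓝[Ioo (-Θ) Θ] t).NeBot := mem_closure_iff_nhdsWithin_neBot.1 hcl
    refine mem_frontier_of_tendsto_comp_holomorphic (l := 𝓝[Ioo (-Θ) Θ] t)
      (u := circleMap 0 r) isOpen_ball hWo hg hbij ?_ (fun h => ht' ((hmem t (hIπ t ht)).1 h))
      ((continuous_circleMap 0 r).tendsto t |>.mono_left nhdsWithin_le_nhds) ?_
    · filter_upwards [self_mem_nhdsWithin] with θ hθ
      exact (hmem θ (hIπ θ (Ioo_subset_Icc_self hθ))).2 hθ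
    · refine ((hGcont.tendsto t).mono_left nhdsWithin_le_nhds).congr' ?_
      filter_upwards [self_mem_nhdsWithin] with θ hθ using hGh θ hθ
  refine ⟨G (-Θ), hend _ ⟨le_rfl, by linarith⟩ (by simp), G Θ,
    hend _ ⟨by linarith, le_rfl⟩ (by simp), hGdist _ _, G '' Icc (-Θ) Θ,
    isCompact_Icc.image hGcont, ?_, ?_, ⟨_, ⟨le_rfl, by linarith⟩, rfl⟩,
    ⟨_, ⟨by linarith, le_rfl⟩, rfl⟩, ?_⟩
  · rintro _ ⟨x, -, rfl⟩
    exact (hGdist _ _).le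
  · rintro _ ⟨z, ⟨hz, hzr⟩, rfl⟩
    have hzr' : ‖z‖ = r := by simpa using hzr
    have hzc : circleMap 0 r z.arg = z := by
      rw [circleMap_zero, ← hzr', Complex.norm_mul_exp_arg_mul_I]
    have harg := (hmem z.arg (Complex.abs_arg_le_pi z)).1 (by rwa [hzc])
    refine ⟨z.arg, Ioo_subset_Icc_self harg, ?_⟩
    rw [hGh _ harg, hh]
    simp only [hzc]
  · rintro _ ⟨⟨x, hx, rfl⟩, hxf⟩
    by_cases hx' : x ∈ Ioo (-Θ) Θ
    · rw [hWo.frontier_eq] at hxf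
      refine absurd (hbij.mapsTo ((hmem x (hIπ x hx)).2 hx')) ?_
      rw [hGh x hx'] at hxf
      exact hxf.2
    · rcases hx.1.eq_or_lt with h1 | h1
      · exact Or.inl (by rw [h1])
      · rcases hx.2.eq_or_lt with h2 | h2
        · exact Or.inr (by rw [h2]; rfl)
        · exact absurd ⟨h1, h2⟩ hx'

/-- If `∂W` is locally connected, a conformal map of a disk onto `W` has arbitrarily small
oscillation near each boundary point. -/
theorem exists_image_subset_closedBall {g : ℂ → ℂ} {W : Set ℂ} (hWb : Bornology.IsBounded W)
    (hWo : IsOpen W) [LocallyConnectedSpace (frontier W)]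
    (hg : DifferentiableOn ℂ g (ball 1 1)) (hbij : BijOn g (ball 1 1) W) {ε : ℝ} (hε : 0 < ε) :
    ∃ r > 0, ∃ a, ∀ z ∈ ball (1 : ℂ) 1 ∩ ball 0 r, dist (g z) a ≤ ε := by
  have h1mem : (1 : ℂ) ∈ ball (1 : ℂ) 1 := mem_ball_self one_pos
  have hWc : IsPreconnected W := by
    rw [← hbij.image_eq]
    exact (convex_ball (1 : ℂ) 1).isPreconnected.image _ hg.continuousOn
  obtain ⟨ρ, hρ, hρW⟩ := Metric.isOpen_iff.1 hWo (g 1) (hbij.mapsTo h1mem)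
  obtain ⟨η, hη, hηε, hηρ⟩ : ∃ η > 0, η ≤ ε ∧ η < ρ :=
    ⟨min ε (ρ / 2), by positivity, min_le_left _ _, (min_le_right _ _).trans_lt (by linarith)⟩
  have hcomp : IsCompact (frontier W) :=
    Metric.isCompact_of_isClosed_isBounded isClosed_frontier
      (hWb.closure.subset frontier_subset_closure)
  obtain ⟨δ, hδ, hloc⟩ := hcomp.exists_isPreconnected_of_dist_lt hη
  set φ : ℂ → ENNReal := (ball 1 1).indicator fun z => ‖deriv g z‖ₑ with hφ
  have hφmeas : Measurable φ := (measurable_deriv g).enorm.indicator isOpen_ball.measurableSet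
  have hφfin : ∫⁻ z, φ z ^ 2 ≠ ⊤ := by
    have : ∀ z, φ z ^ 2 = (ball 1 1).indicator (fun z => ‖deriv g z‖ₑ ^ 2) z := fun z => by
      by_cases hz : z ∈ ball (1 : ℂ) 1 <;> simp [hφ, hz]
    simp_rw [this]
    rw [lintegral_indicator isOpen_ball.measurableSet,
      lintegral_enorm_deriv_sq_eq_volume_image isOpen_ball hg hbij.injOn, hbij.image_eq]
    exact hWb.measure_lt_top.ne
  obtain ⟨r, ⟨hr, hr1⟩, hlen⟩ := exists_lintegral_circleMap_lt hφmeas hφfin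
    (lt_min hη hδ) one_pos
  obtain ⟨a, haW, b, hbW, hab, C, hC, hCa, hsC, haC, hbC, hCW⟩ :=
    exists_crosscut hWo hg hbij hr hr1 hlen
  obtain ⟨B, hBW, hBcl, hBc, haB, hbB, hBa⟩ :=
    hloc a haW b hbW (hab.trans_le (min_le_right _ _))
  have hdisj : Disjoint W (frontier W) := by
    rw [hWo.frontier_eq]; exact disjoint_sdiff_right
  have hK₂ : B ∪ C ⊆ closedBall a η :=
    union_subset hBa (hCa.trans (closedBall_subset_closedBall (min_le_left _ _)))
  refine ⟨r, hr, a, fun z₁ hz₁ => le_of_not_gt fun hlt => ?_⟩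
  have hfar₁ : η < dist (g z₁) a := hηε.trans_lt hlt
  have hfar₀ : η < dist (g 1) a := hηρ.trans_le <| not_lt.1 fun h =>
    hdisj.le_bot ⟨hρW (mem_ball'.2 h), haW⟩
  have hlog : HasContinuousLogOn (fun z => (z - g z₁) / (z - g 1)) (frontier W ∪ (B ∪ C)) := by
    refine (hasContinuousLogOn_div_of_isPreconnected isClosed_frontier hWc hdisj
      (hbij.mapsTo hz₁.1) (hbij.mapsTo h1mem)).union ?_ isClosed_frontier
      (hBcl.union hC.isClosed) ?_
    · exact (((hasContinuousLogOn_sub_closedBall hfar₁).mul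
        (hasContinuousLogOn_sub_closedBall hfar₀).inv).mono hK₂).congr
        fun z _ => (div_eq_mul_inv _ _).symm
    · convert hBc
      refine Subset.antisymm ?_ fun x hx => ⟨hBW hx, Or.inl hx⟩
      rintro x ⟨hxW, hx | hx⟩
      · exact hx
      · rcases hCW ⟨hx, hxW⟩ with rfl | rfl
        exacts [haB, hbB]
  refine not_hasContinuousLogOn_div (U := g '' (ball 1 1 ∩ ball 0 r))
    (hWb.subset ?_) (isClosed_frontier.union (hBcl.union hC.isClosed)) ?_
    (mem_image_of_mem g hz₁) ?_ ?_ hlog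
  · exact (image_mono inter_subset_left).trans hbij.image_eq.subset
  · intro p hp
    rw [(isOpen_image_of_injOn_holomorphic isOpen_ball hg hbij.injOn inter_subset_left
      (isOpen_ball.inter isOpen_ball)).frontier_eq] at hp
    by_cases hpW : p ∈ W
    · obtain ⟨z, hz, rfl⟩ := hbij.surjOn hpW
      refine Or.inr (Or.inr (hsC ⟨z, ⟨hz, ?_⟩, rfl⟩))
      have hzr : z ∉ ball 0 r := fun h => hp.2 ⟨z, ⟨hz, h⟩, rfl⟩
      obtain ⟨u, hu, hup⟩ := mem_closure_iff_seq_limit.1 hp.1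
      choose v hv hvu using hu
      have hvz : Tendsto v atTop (𝓝 z) := by
        refine tendsto_of_tendsto_comp_holomorphic isOpen_ball hg hbij.injOn
          (Eventually.of_forall fun n => (hv n).1) hz ?_
        convert hup using 1
        exact funext hvu
      have : z ∈ closedBall (0 : ℂ) r := isClosed_closedBall.mem_of_tendsto hvz
        (Eventually.of_forall fun n => ball_subset_closedBall (hv n).2)
      rw [mem_sphere]
      exact le_antisymm (mem_closedBall.1 this) (not_lt.1 hzr)
    · left
      rw [hWo.frontier_eq]
      refine ⟨closure_mono ?_ hp.1, hpW⟩
      exact (image_mono inter_subset_left).trans hbij.image_eq.subset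
  · rintro ⟨z, hz, hz1⟩
    have := hbij.injOn hz.1 h1mem hz1
    subst this
    have := mem_ball_zero_iff.1 hz.2
    simp at this
    linarith
  · rintro (h | h)
    · exact hdisj.le_bot ⟨hbij.mapsTo h1mem, h⟩
    · exact hfar₀.not_ge (mem_closedBall.1 (hK₂ h))

theorem exists_tendsto_of_locallyConnectedSpace_frontier {f : ℂ → ℂ} {W : Set ℂ}
    (hWb : Bornology.IsBounded W) (hWo : IsOpen W) [LocallyConnectedSpace (frontier W)]
    (hf : DifferentiableOn ℂ f (ball 0 1)) (hbij : BijOn f (ball 0 1) W) {ζ : ℂ}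
    (hζ : ‖ζ‖ = 1) : ∃ w, Tendsto f (𝓝[ball 0 1] ζ) (𝓝 w) := by
  have hζ0 : ζ ≠ 0 := norm_ne_zero_iff.1 (by rw [hζ]; exact one_ne_zero)
  have hT : BijOn (fun z => ζ * (1 - z)) (ball 1 1) (ball 0 1) := by
    refine ⟨fun z hz => ?_, fun x _ y _ h => ?_, fun z hz => ⟨1 - z / ζ, ?_, ?_⟩⟩
    · rw [mem_ball_zero_iff, norm_mul, hζ, one_mul, ← dist_eq_norm]
      exact mem_ball'.1 hz
    · simpa [hζ0] using h
    · rw [mem_ball, dist_eq_norm]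
      simpa [hζ] using hz
    · simp [mul_div_cancel₀ _ hζ0]
  have hg : DifferentiableOn ℂ (f ∘ fun z => ζ * (1 - z)) (ball 1 1) :=
    hf.comp (by fun_prop) hT.mapsTo
  have hcl : ζ ∈ closure (ball (0 : ℂ) 1) := by
    rw [closure_ball _ one_ne_zero]; simp [hζ]
  have : (𝓝[ball 0 1] ζ).NeBot := mem_closure_iff_nhdsWithin_neBot.1 hcl
  apply cauchy_map_iff_exists_tendsto.1
  refine Metric.cauchy_iff.2 ⟨inferInstance, fun ε hε => ?_⟩
  obtain ⟨r, hr, a, ha⟩ := exists_image_subset_closedBall hWb hWo hg (hbij.comp hT)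
    (show 0 < ε / 3 by positivity)
  refine ⟨f '' (ball 0 1 ∩ ball ζ r), image_mem_map (inter_mem self_mem_nhdsWithin
    (mem_nhdsWithin_of_mem_nhds (ball_mem_nhds ζ hr))), ?_⟩
  have key : ∀ z ∈ ball 0 1 ∩ ball ζ r, dist (f z) a ≤ ε / 3 := by
    rintro z ⟨hz, hzr⟩
    obtain ⟨y, hy, rfl⟩ := hT.surjOn hz
    refine ha y ⟨hy, ?_⟩
    rw [mem_ball, dist_eq_norm] at hzr
    rw [mem_ball_zero_iff]
    have : ζ * (1 - y) - ζ = -(ζ * y) := by ring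
    simpa [this, hζ] using hzr
  rintro _ ⟨x, hx, rfl⟩ _ ⟨y, hy, rfl⟩
  have := dist_triangle_right (f x) (f y) a
  linarith [key x hx, key y hy]

/-- The image of the unit circle under a continuous map is locally connected. -/
theorem locallyConnectedSpace_image_sphere {F : ℂ → ℂ} (hF : ContinuousOn F (sphere 0 1)) :
    LocallyConnectedSpace (F '' sphere 0 1) := by
  have : Fact ((0 : ℝ) < 1) := ⟨one_pos⟩
  have hmk := QuotientAddGroup.isQuotientMap_mk (N := AddSubgroup.zmultiples (1 : ℝ))
  have : LocallyConnectedSpace UnitAddCircle := hmk.isCoinducing.locallyConnectedSpace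
  set q : UnitAddCircle → F '' sphere 0 1 := fun t =>
    ⟨F (AddCircle.toCircle t), mem_image_of_mem F (by simp [Circle.norm_coe])⟩ with hq
  have hqc : Continuous q := Continuous.subtype_mk
    (hF.comp_continuous (by fun_prop) fun t => by simp [Circle.norm_coe]) _
  have hqs : Function.Surjective q := by
    rintro ⟨_, z, hz, rfl⟩
    obtain ⟨t, ht⟩ := (AddCircle.homeomorphCircle (one_ne_zero (α := ℝ))).surjective
      ⟨z, by simpa [Submonoid.unitSphere] using hz⟩
    refine ⟨t, Subtype.ext ?_⟩
    rw [AddCircle.homeomorphCircle_apply] at ht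
    simp [hq, ht]
  exact (hqc.isClosedMap.isQuotientMap hqc hqs).isCoinducing.locallyConnectedSpace

theorem image_sphere_eq_frontier {f F : ℂ → ℂ} {W : Set ℂ} (hWo : IsOpen W)
    (hf : DifferentiableOn ℂ f (ball 0 1)) (hbij : BijOn f (ball 0 1) W)
    (hF : ContinuousOn F (closedBall 0 1)) (hFf : ∀ z ∈ ball 0 1, F z = f z) :
    F '' sphere 0 1 = frontier W := by
  have hFW : F '' ball 0 1 = W := (image_congr hFf).trans hbij.image_eq
  have hcl : closure (ball (0 : ℂ) 1) = closedBall 0 1 := closure_ball _ one_ne_zero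
  refine Subset.antisymm ?_ fun w hw => ?_
  · rintro _ ⟨z, hz, rfl⟩
    have hz' : z ∈ closedBall (0 : ℂ) 1 := sphere_subset_closedBall hz
    have : (𝓝[ball 0 1] z).NeBot := mem_closure_iff_nhdsWithin_neBot.1 (hcl ▸ hz')
    refine mem_frontier_of_tendsto_comp_holomorphic (l := 𝓝[ball 0 1] z) (u := id) isOpen_ball hWo
      hf hbij self_mem_nhdsWithin (z := z) ?_ (tendsto_id.mono_left nhdsWithin_le_nhds) ?_
    · simpa using (mem_sphere_zero_iff_norm.1 hz).ge
    · refine ((hF z hz').mono_left (nhdsWithin_mono _ ball_subset_closedBall)).congr' ?_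
      filter_upwards [self_mem_nhdsWithin] with x hx using hFf x hx
  · rw [hWo.frontier_eq] at hw
    have hsub : closure W ⊆ F '' closedBall 0 1 :=
      closure_minimal (hFW ▸ image_mono ball_subset_closedBall)
        ((isCompact_closedBall 0 1).image_of_continuousOn hF).isClosed
    obtain ⟨z, hz, rfl⟩ := hsub hw.1
    refine ⟨z, le_antisymm (mem_closedBall.1 hz) (not_lt.1 fun h => hw.2 ?_), rfl⟩
    exact hFW ▸ mem_image_of_mem F (mem_ball.2 h)

/-- **Carathéodory Theorem (local-connectivity form).**
A conformal mapping `f : 𝔻 → W` extends continuously to the closed unit disk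
if and only if `∂W` is locally connected. -/
theorem caratheodory_extension_iff_locallyConnected
    (W : Set ℂ) (hWb : Bornology.IsBounded W) (hWo : IsOpen W)
    (hWc : IsConnected W) (hWsc : SimplyConnectedSpace W)
    (f : ℂ → ℂ) (hdiff : DifferentiableOn ℂ f (Metric.ball 0 1))
    (hbij : Set.BijOn f (Metric.ball 0 1) W) :
    (∃ F : ℂ → ℂ, ContinuousOn F (closure (Metric.ball 0 1)) ∧
        ∀ z ∈ Metric.ball (0:ℂ) 1, F z = f z) ↔
      LocallyConnectedSpace (frontier W) := by
  constructor
  · rintro ⟨F, hF, hFf⟩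
    rw [closure_ball _ one_ne_zero] at hF
    rw [← image_sphere_eq_frontier hWo hdiff hbij hF hFf]
    exact locallyConnectedSpace_image_sphere (hF.mono sphere_subset_closedBall)
  · intro hloc
    refine ⟨extendFrom (ball 0 1) f, continuousOn_extendFrom subset_rfl fun x hx => ?_,
      fun z hz => extendFrom_eq (subset_closure hz) (hdiff.continuousOn z hz)⟩
    by_cases hx1 : x ∈ ball (0 : ℂ) 1
    · exact ⟨f x, hdiff.continuousOn x hx1⟩
    · rw [closure_ball _ one_ne_zero] at hx
      refine exists_tendsto_of_locallyConnectedSpace_frontier hWb hWo hdiff hbij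
        (le_antisymm (by simpa using hx) (by simpa using hx1))
end

section
/- Let W ⊆ ℂ be a bounded, open, connected, simply connected set and let γ be a crosscut of W. Then W ∖ γ((0,1)) has exactly two connected components. -/
/-- A crosscut of `W`: a continuous injective map `γ : [0,1] → ℂ` with
`γ(t) ∈ W` for `t ∈ (0,1)` and endpoints on `∂W`. -/
def IsCrosscut (W : Set ℂ) (γ : ℝ → ℂ) : Prop :=
  ContinuousOn γ (Set.Icc 0 1) ∧ Set.InjOn γ (Set.Icc 0 1) ∧
    (∀ t ∈ Set.Ioo (0:ℝ) 1, γ t ∈ W) ∧ γ 0 ∈ frontier W ∧ γ 1 ∈ frontier W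

open Set Topology Complex in
/-- Two continuous logarithms of the same function on a preconnected set differ by a constant. -/
theorem exists_eqOn_add_const_of_exp_eq {X : Type*} [TopologicalSpace X] {S : Set X}
    (hS : IsPreconnected S) {g h : X → ℂ} (hg : ContinuousOn g S) (hh : ContinuousOn h S)
    (hgh : ∀ x ∈ S, exp (g x) = exp (h x)) :
    ∃ c : ℂ, exp c = 1 ∧ ∀ x ∈ S, g x = h x + c := by
  have hT : IsDiscrete ((AddSubgroup.zmultiples (2 * Real.pi * I : ℂ) : AddSubgroup ℂ) : Set ℂ) :=
    ⟨NormedSpace.discreteTopology_zmultiples _⟩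
  have hmaps : MapsTo (fun x => g x - h x) S
      ((AddSubgroup.zmultiples (2 * Real.pi * I : ℂ) : AddSubgroup ℂ) : Set ℂ) := by
    intro x hx
    obtain ⟨n, hn⟩ := exp_eq_exp_iff_exists_int.1 (hgh x hx)
    refine AddSubgroup.mem_zmultiples_iff.2 ⟨n, ?_⟩
    simp [hn]
  obtain ⟨c, hc, hceq⟩ := hS.eqOn_const_of_mapsTo hT (hg.sub hh) hmaps ⟨0, zero_mem _⟩
  refine ⟨c, ?_, fun x hx => ?_⟩
  · obtain ⟨n, rfl⟩ := AddSubgroup.mem_zmultiples_iff.1 hc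
    rw [zsmul_eq_mul]
    exact exp_int_mul_two_pi_mul_I n
  · rw [← show g x - h x = c from hceq hx]
    ring

open Set Topology Complex in
/-- If `p` and `q` are joined by a path avoiding `S`, then `(z - p) / (z - q)` has a continuous
logarithm on `S`. -/
theorem JoinedIn.exists_continuousOn_exp_eq {S : Set ℂ} {p q : ℂ} (hpq : JoinedIn Sᶜ p q) :
    ∃ g : ℂ → ℂ, ContinuousOn g S ∧ ∀ z ∈ S, exp (g z) = (z - p) / (z - q) := by
  obtain ⟨γ, hγ⟩ := hpq.symm
  have hne : ∀ (t : unitInterval) (z : S), (z : ℂ) - γ t ≠ 0 := fun t z h =>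
    hγ t (sub_eq_zero.1 h ▸ z.2)
  have hq : ∀ z : S, (z : ℂ) - q ≠ 0 := fun z => by simpa using hne 0 z
  let H : C(unitInterval × S, {z : ℂ // z ≠ 0}) :=
    ⟨fun x => ⟨((x.2 : ℂ) - γ x.1) / (x.2 - q), div_ne_zero (hne _ _) (hq _)⟩, by
      refine Continuous.subtype_mk (Continuous.div ?_ ?_ fun x : unitInterval × S => hq x.2) _ <;> fun_prop⟩
  have H0 : ∀ a : S, H (0, a) = ⟨_, exp_ne_zero ((0 : C(S, ℂ)) a)⟩ := fun a => by
    ext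
    simp [H, div_self (hq a)]
  let F := isCoveringMap_exp.liftHomotopy H 0 H0
  have hF : ∀ z : S, exp (F (1, z)) = (z - p) / (z - q) := fun z => by
    have := congrArg Subtype.val
      (congrFun (isCoveringMap_exp.liftHomotopy_lifts H 0 H0) (1, z))
    exact this.trans (by simp [H])
  refine ⟨Function.extend Subtype.val (fun z : S => F (1, z)) 0, ?_, fun z hz => ?_⟩
  · rw [continuousOn_iff_continuous_domRestrict]
    have : S.domRestrict (Function.extend Subtype.val (fun z : S => F (1, z)) 0) =
        fun z => F (1, z) := by
      ext z
      exact Subtype.val_injective.extend_apply _ _ z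
    rw [this]
    fun_prop
  · rw [Subtype.val_injective.extend_apply (fun z : S => F (1, z)) 0 ⟨z, hz⟩]
    exact hF ⟨z, hz⟩

/-- The whole of a contractible space is simply connected. -/
theorem isSimplyConnected_univ_of_contractible {X : Type*} [TopologicalSpace X]
    [ContractibleSpace X] : IsSimplyConnected (Set.univ : Set X) :=
  have := (Homeomorph.Set.univ X).contractibleSpace
  show SimplyConnectedSpace (Set.univ : Set X) from inferInstance

open Set Topology Complex in
/-- A continuous nonvanishing function on an arc has a continuous logarithm. -/
theorem exists_continuousOn_exp_eq_of_arc {γ : ℝ → ℂ} (hγ : ContinuousOn γ (Icc 0 1))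
    (hinj : InjOn γ (Icc 0 1)) {f : ℂ → ℂ} (hf : ContinuousOn f (γ '' Icc 0 1))
    (hf0 : ∀ z ∈ γ '' Icc 0 1, f z ≠ 0) :
    ∃ g : ℂ → ℂ, ContinuousOn g (γ '' Icc 0 1) ∧ ∀ z ∈ γ '' Icc 0 1, exp (g z) = f z := by
  have hproj : ∀ t : ℝ, (projIcc (0 : ℝ) 1 zero_le_one t : ℝ) ∈ Icc (0 : ℝ) 1 := fun t =>
    (projIcc (0 : ℝ) 1 zero_le_one t).2
  have hcont : Continuous fun t : ℝ => f (γ (projIcc (0 : ℝ) 1 zero_le_one t)) := by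
    have h1 : Continuous fun t : ℝ => (projIcc (0 : ℝ) 1 zero_le_one t : ℝ) :=
      continuous_subtype_val.comp continuous_projIcc
    exact hf.comp_continuous (hγ.comp_continuous h1 hproj)
      fun t => mem_image_of_mem γ (hproj t)
  have hsc : IsSimplyConnected (univ : Set ℝ) :=
    isSimplyConnected_univ_of_contractible
  obtain ⟨φ, hφ, hφe⟩ := exists_continuousOn_eqOn_exp_comp hsc isOpen_univ hcont.continuousOn
    (by rintro ⟨t, -, ht⟩; exact hf0 _ (mem_image_of_mem γ (hproj t)) ht)
  have hemb : IsClosedEmbedding ((Icc (0 : ℝ) 1).domRestrict γ) :=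
    (continuousOn_iff_continuous_domRestrict.1 hγ).isClosedEmbedding
      (injOn_iff_injective.1 hinj)
  obtain ⟨g, hg⟩ := ContinuousMap.exists_extension' hemb
    ⟨(Icc (0 : ℝ) 1).domRestrict φ, (continuousOn_univ.1 hφ).comp continuous_subtype_val⟩
  refine ⟨g, g.continuous.continuousOn, ?_⟩
  rintro _ ⟨t, ht, rfl⟩
  have hgt : g (γ t) = φ t := congrFun hg ⟨t, ht⟩
  have := hφe (mem_univ t)
  simp only [Function.comp_apply, projIcc_of_mem zero_le_one ht] at this
  rw [hgt, this]

open Set Topology Complex in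
/-- The power `(z - q) ^ k` has no continuous logarithm on a circle around `q` unless `k = 0`. -/
theorem eq_zero_of_exp_eq_zpow_on_sphere {q : ℂ} {R : ℝ} (hR : 0 < R) {k : ℤ} {φ : ℂ → ℂ}
    (hφ : Continuous φ) (h : ∀ z ∈ Metric.sphere q R, exp (φ z) = (z - q) ^ k) : k = 0 := by
  have hR' : (R : ℂ) ≠ 0 := by exact_mod_cast hR.ne'
  obtain ⟨c, -, hc⟩ := exists_eqOn_add_const_of_exp_eq (isPreconnected_univ (α := ℝ))
    (g := fun θ : ℝ => φ (circleMap q R θ)) (h := fun θ : ℝ => k * (log R + θ * I))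
    (by fun_prop) (by fun_prop) (fun θ _ => by
      rw [h _ (circleMap_mem_sphere q hR.le θ), exp_int_mul, exp_add, exp_log hR']
      simp [circleMap])
  have h0 := hc 0 (mem_univ _)
  have h1 := hc (2 * Real.pi) (mem_univ _)
  have hp : circleMap q R (2 * Real.pi) = circleMap q R 0 := by
    simpa using periodic_circleMap q R 0
  rw [hp, h0] at h1
  have h2 : (k : ℂ) * (2 * Real.pi * I) = 0 := by
    push_cast at h1
    linear_combination -h1
  simpa [two_pi_I_ne_zero, Real.pi_ne_zero] using h2

open Set Topology Complex in
/-- A function on the frontier of a bounded open set `U` of the form `exp g * G`, with `G`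
continuous and nonvanishing on `closure U`, cannot equal a nontrivial power of `z - q`, `q ∈ U`. -/
theorem eq_zero_of_exp_mul_eq_zpow_on_frontier {U : Set ℂ} (hUo : IsOpen U)
    (hUb : Bornology.IsBounded U) {q : ℂ} (hq : q ∈ U) {k : ℤ} {g G : ℂ → ℂ}
    (hg : ContinuousOn g (frontier U)) (hG : ContinuousOn G (closure U))
    (hG0 : ∀ z ∈ closure U, G z ≠ 0)
    (h : ∀ z ∈ frontier U, exp (g z) * G z = (z - q) ^ k) : k = 0 := by
  classical
  obtain ⟨e, he⟩ := ContinuousMap.exists_restrict_eq (isClosed_frontier (s := U))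
    ⟨(frontier U).domRestrict g, continuousOn_iff_continuous_domRestrict.1 hg⟩
  have he' : ∀ z ∈ frontier U, e z = g z := fun z hz => by
    simpa using DFunLike.congr_fun he ⟨z, hz⟩
  have hnotU : ∀ z ∈ closure Uᶜ, z - q ≠ 0 := fun z hz hzq => by
    rw [hUo.isClosed_compl.closure_eq, sub_eq_zero.1 hzq] at hz
    exact hz hq
  have hFc : ContinuousOn (U.piecewise (fun z => exp (e z) * G z) (fun z => (z - q) ^ k)) univ := by
    refine ContinuousOn.piecewise (fun z hz => ?_) ?_ ?_
    · rw [he' z hz.2, h z hz.2]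
    · exact ((continuous_exp.comp e.continuous).continuousOn.mul (hG.mono inter_subset_right))
    · exact ContinuousOn.zpow₀ (by fun_prop) k fun z hz => Or.inl (hnotU z hz.2)
  obtain ⟨φ, hφ, hφe⟩ := exists_continuousOn_eqOn_exp_comp isSimplyConnected_univ_of_contractible
    isOpen_univ hFc (by
      rintro ⟨z, -, hz⟩
      by_cases hzU : z ∈ U
      · rw [piecewise_eq_of_mem _ _ _ hzU] at hz
        exact mul_ne_zero (exp_ne_zero _) (hG0 z (subset_closure hzU)) hz
      · rw [piecewise_eq_of_notMem _ _ _ hzU] at hz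
        exact zpow_ne_zero k (hnotU z (subset_closure hzU)) hz)
  obtain ⟨R, hR0, hR⟩ := hUb.subset_ball_lt 0 q
  refine eq_zero_of_exp_eq_zpow_on_sphere (q := q) hR0 (continuousOn_univ.1 hφ) fun z hz => ?_
  have hzU : z ∉ U := fun hzU => (Metric.mem_ball.1 (hR hzU)).ne hz
  have := hφe (mem_univ z)
  rwa [Function.comp_apply, piecewise_eq_of_notMem _ _ _ hzU] at this

open Set Topology Complex in
/-- Continuous logarithms on two closed sets can be glued if the mismatch is the same integer
multiple of `2πi` at all common points. -/
theorem exists_continuousOn_exp_eq_union {X A : Set ℂ} (hX : IsClosed X) (hA : IsClosed A)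
    {f g h : ℂ → ℂ} (hg : ContinuousOn g X) (hh : ContinuousOn h A)
    (hgf : ∀ z ∈ X, exp (g z) = f z) (hhf : ∀ z ∈ A, exp (h z) = f z) {m : ℤ}
    (hm : ∀ z ∈ X ∩ A, g z = h z + m * (2 * Real.pi * I)) :
    ∃ u : ℂ → ℂ, ContinuousOn u (X ∪ A) ∧ ∀ z ∈ X ∪ A, exp (u z) = f z := by
  classical
  have hXe : EqOn (X.piecewise g fun z => h z + m * (2 * Real.pi * I)) g X := fun z hz =>
    piecewise_eq_of_mem _ _ _ hz
  have hAe : EqOn (X.piecewise g fun z => h z + m * (2 * Real.pi * I))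
      (fun z => h z + m * (2 * Real.pi * I)) A := fun z hz => by
    by_cases hzX : z ∈ X
    · rw [hXe hzX, hm z ⟨hzX, hz⟩]
    · exact piecewise_eq_of_notMem _ _ _ hzX
  refine ⟨_, (hg.congr hXe).union_of_isClosed ((hh.add continuousOn_const).congr hAe) hX hA, ?_⟩
  rintro z (hz | hz)
  · rw [hXe hz, hgf z hz]
  · rw [hAe hz]
    simp only [exp_add, exp_int_mul_two_pi_mul_I, mul_one, hhf z hz]

open Set Topology Complex in
/-- If two closed sets meet in at most two points and two functions have continuous logarithms on
each of them, then some nontrivial monomial in these functions has a continuous logarithm on the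
union. -/
theorem exists_continuousOn_exp_eq_zpow_mul_zpow {X A : Set ℂ} (hX : IsClosed X)
    (hA : IsClosed A) {a b : ℂ} (hab : X ∩ A = {a, b}) {f₁ f₂ g₁ g₂ h₁ h₂ : ℂ → ℂ}
    (hg₁ : ContinuousOn g₁ X) (hg₂ : ContinuousOn g₂ X)
    (hh₁ : ContinuousOn h₁ A) (hh₂ : ContinuousOn h₂ A)
    (hgf₁ : ∀ z ∈ X, exp (g₁ z) = f₁ z) (hgf₂ : ∀ z ∈ X, exp (g₂ z) = f₂ z)
    (hhf₁ : ∀ z ∈ A, exp (h₁ z) = f₁ z) (hhf₂ : ∀ z ∈ A, exp (h₂ z) = f₂ z) :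
    ∃ k l : ℤ, (k ≠ 0 ∨ l ≠ 0) ∧ ∃ u : ℂ → ℂ, ContinuousOn u (X ∪ A) ∧
      ∀ z ∈ X ∪ A, exp (u z) = f₁ z ^ k * f₂ z ^ l := by
  have ha : a ∈ X ∩ A := hab ▸ mem_insert a _
  have hb : b ∈ X ∩ A := hab ▸ mem_insert_of_mem a rfl
  have key : ∀ {f g h : ℂ → ℂ}, (∀ z ∈ X, exp (g z) = f z) → (∀ z ∈ A, exp (h z) = f z) →
      ∀ z ∈ X ∩ A, ∃ n : ℤ, g z = h z + n * (2 * Real.pi * I) := fun hg hh z hz =>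
    exp_eq_exp_iff_exists_int.1 ((hg z hz.1).trans (hh z hz.2).symm)
  obtain ⟨m₁, hm₁⟩ := key hgf₁ hhf₁ a ha
  obtain ⟨n₁, hn₁⟩ := key hgf₁ hhf₁ b hb
  obtain ⟨m₂, hm₂⟩ := key hgf₂ hhf₂ a ha
  obtain ⟨n₂, hn₂⟩ := key hgf₂ hhf₂ b hb
  obtain ⟨k, l, hkl, hrel⟩ : ∃ k l : ℤ, (k ≠ 0 ∨ l ≠ 0) ∧
      k * (m₁ - n₁) + l * (m₂ - n₂) = 0 := by
    by_cases h : m₁ - n₁ = 0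
    · exact ⟨1, 0, Or.inl one_ne_zero, by simp [h]⟩
    · exact ⟨m₂ - n₂, -(m₁ - n₁), Or.inr (neg_ne_zero.2 h), by ring⟩
  refine ⟨k, l, hkl, exists_continuousOn_exp_eq_union hX hA
    (g := fun z => k * g₁ z + l * g₂ z) (h := fun z => k * h₁ z + l * h₂ z)
    (m := k * m₁ + l * m₂) (by fun_prop) (by fun_prop) (fun z hz => ?_) (fun z hz => ?_) ?_⟩
  · rw [exp_add, exp_int_mul, exp_int_mul, hgf₁ z hz, hgf₂ z hz]
  · rw [exp_add, exp_int_mul, exp_int_mul, hhf₁ z hz, hhf₂ z hz]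
  · rw [hab]
    have hrel' : (k : ℂ) * (m₁ - n₁) + l * (m₂ - n₂) = 0 := by exact_mod_cast hrel
    rintro z (rfl | rfl)
    · push_cast
      rw [hm₁, hm₂]
      ring
    · push_cast
      rw [hn₁, hn₂]
      linear_combination -(2 * Real.pi * I) * hrel'

open Set Topology Complex in
/-- The exponent of `z - q` in a monomial with a continuous logarithm on a closed set `K` vanishes
if `q` lies in a bounded open set with frontier in `K` not containing the other base points. -/
theorem eq_zero_of_exp_eq_zpow_mul_zpow {K U : Set ℂ} (hUo : IsOpen U)
    (hUb : Bornology.IsBounded U) (hUK : frontier U ⊆ K) {p q r : ℂ} (hq : q ∈ U)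
    (hqK : q ∉ K) (hpU : p ∉ closure U) (hrU : r ∉ closure U) {k l : ℤ} {u : ℂ → ℂ}
    (hu : ContinuousOn u K)
    (h : ∀ z ∈ K, exp (u z) = ((z - p) / (z - q)) ^ k * ((z - p) / (z - r)) ^ l) : k = 0 := by
  have hne : ∀ {w : ℂ}, w ∉ closure U → ∀ z ∈ closure U, z - w ≠ 0 := fun hw z hz hzw =>
    hw (sub_eq_zero.1 hzw ▸ hz)
  refine eq_zero_of_exp_mul_eq_zpow_on_frontier hUo hUb hq (g := fun z => -u z)
    (G := fun z => (z - p) ^ k * ((z - p) / (z - r)) ^ l) (hu.mono hUK).neg ?_ ?_ ?_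
  · refine ContinuousOn.mul (ContinuousOn.zpow₀ (by fun_prop) k fun z hz => Or.inl (hne hpU z hz))
      (ContinuousOn.zpow₀ (ContinuousOn.div (by fun_prop) (by fun_prop) (hne hrU)) l
        fun z hz => Or.inl (div_ne_zero (hne hpU z hz) (hne hrU z hz)))
  · exact fun z hz => mul_ne_zero (zpow_ne_zero _ (hne hpU z hz))
      (zpow_ne_zero _ (div_ne_zero (hne hpU z hz) (hne hrU z hz)))
  · intro z hz
    have hzp := hne hpU z hz.1
    have hzr := hne hrU z hz.1
    have hzq : z - q ≠ 0 := fun hzq => hqK (sub_eq_zero.1 hzq ▸ hUK hz)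
    rw [exp_neg, h z (hUK hz), div_zpow (z - p) (z - q)]
    have h1 := zpow_ne_zero k hzp
    have h2 := zpow_ne_zero k hzq
    have h3 := zpow_ne_zero l (div_ne_zero hzp hzr)
    field_simp

open Set Topology in
/-- The frontier of a connected component of an open set is disjoint from that set. -/
theorem IsOpen.frontier_connectedComponentIn_subset_compl {O : Set ℂ} (hO : IsOpen O) (q : ℂ) :
    frontier (connectedComponentIn O q) ⊆ Oᶜ := by
  intro z hz hzO
  obtain ⟨w, hw, hwq⟩ := mem_closure_iff.1 hz.1 _ hO.connectedComponentIn
    (mem_connectedComponentIn hzO)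
  have heq := (connectedComponentIn_eq hwq).trans (connectedComponentIn_eq hw).symm
  have hzq : z ∈ connectedComponentIn O q := heq ▸ mem_connectedComponentIn hzO
  rw [hO.connectedComponentIn.frontier_eq] at hz
  exact hz.2 hzq

namespace IsCrosscut

open Set Topology Complex

variable {W : Set ℂ} {γ : ℝ → ℂ}

theorem isClosed_image (hγ : IsCrosscut W γ) : IsClosed (γ '' Icc 0 1) :=
  (isCompact_Icc.image_of_continuousOn hγ.1).isClosed

theorem image_Icc (γ : ℝ → ℂ) : γ '' Icc 0 1 = γ '' Ioo 0 1 ∪ {γ 0, γ 1} := by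
  rw [← Ioo_union_both (zero_le_one (α := ℝ)), image_union, image_pair]

theorem compl_inter_image (hWo : IsOpen W) (hγ : IsCrosscut W γ) :
    Wᶜ ∩ γ '' Icc 0 1 = {γ 0, γ 1} := by
  obtain ⟨-, -, hmem, h0, h1⟩ := hγ
  rw [hWo.frontier_eq] at h0 h1
  rw [image_Icc]
  ext z
  constructor
  · rintro ⟨hz, ⟨t, ht, rfl⟩ | hz'⟩
    · exact absurd (hmem t ht) hz
    · exact hz'
  · rintro (rfl | rfl)
    · exact ⟨h0.2, Or.inr (mem_insert _ _)⟩
    · exact ⟨h1.2, Or.inr (mem_insert_of_mem _ rfl)⟩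

theorem diff_eq (hWo : IsOpen W) (hγ : IsCrosscut W γ) :
    W \ γ '' Ioo 0 1 = (Wᶜ ∪ γ '' Icc 0 1)ᶜ := by
  have h0 := hγ.2.2.2.1
  have h1 := hγ.2.2.2.2
  rw [hWo.frontier_eq] at h0 h1
  rw [image_Icc]
  ext z
  simp only [mem_sdiff, compl_union, compl_compl, mem_inter_iff, mem_compl_iff,
    mem_insert_iff, mem_singleton_iff, not_or]
  refine ⟨fun ⟨h, h'⟩ => ⟨h, h', ?_, ?_⟩, fun ⟨h, h', _⟩ => ⟨h, h'⟩⟩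
  · rintro rfl
    exact h0.2 h
  · rintro rfl
    exact h1.2 h

theorem isOpen_diff (hWo : IsOpen W) (hγ : IsCrosscut W γ) : IsOpen (W \ γ '' Ioo 0 1) := by
  rw [hγ.diff_eq hWo]
  exact (hWo.isClosed_compl.union hγ.isClosed_image).isOpen_compl

/-- Of any three points off the crosscut, two lie in the same component. -/
theorem connectedComponentIn_eq_of_three (hWb : Bornology.IsBounded W) (hWo : IsOpen W)
    (hWc : IsConnected W) (hγ : IsCrosscut W γ) {p q r : ℂ} (hp : p ∈ W \ γ '' Ioo 0 1)
    (hq : q ∈ W \ γ '' Ioo 0 1) (hr : r ∈ W \ γ '' Ioo 0 1) :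
    p ∈ connectedComponentIn (W \ γ '' Ioo 0 1) q ∨
      p ∈ connectedComponentIn (W \ γ '' Ioo 0 1) r ∨
      q ∈ connectedComponentIn (W \ γ '' Ioo 0 1) r := by
  by_contra! hcon
  obtain ⟨hpq, hpr, hqr⟩ := hcon
  have hO := hγ.isOpen_diff hWo
  have hdiff := hγ.diff_eq hWo
  set O := W \ γ '' Ioo 0 1 with hOdef
  have hrq : r ∉ connectedComponentIn O q := fun h => hqr <| by
    rw [← connectedComponentIn_eq h]
    exact mem_connectedComponentIn hq
  have hWp : IsPathConnected W := hWo.isConnected_iff_isPathConnected.1 hWc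
  have hX : ∀ w ∈ O, ∃ g : ℂ → ℂ, ContinuousOn g Wᶜ ∧
      ∀ z ∈ Wᶜ, exp (g z) = (z - p) / (z - w) := fun w hw =>
    JoinedIn.exists_continuousOn_exp_eq (by
      rw [compl_compl]
      exact hWp.joinedIn p hp.1 w hw.1)
  have hA : ∀ w ∈ O, ∃ g : ℂ → ℂ, ContinuousOn g (γ '' Icc 0 1) ∧
      ∀ z ∈ γ '' Icc 0 1, exp (g z) = (z - p) / (z - w) := fun w hw => by
    have hne : ∀ v ∈ O, ∀ z ∈ γ '' Icc 0 1, z - v ≠ 0 := fun v hv z hz hzv => by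
      rw [hdiff] at hv
      exact hv (Or.inr (sub_eq_zero.1 hzv ▸ hz))
    exact exists_continuousOn_exp_eq_of_arc hγ.1 hγ.2.1
      (ContinuousOn.div (by fun_prop) (by fun_prop) (hne w hw))
      fun z hz => div_ne_zero (hne p hp z hz) (hne w hw z hz)
  obtain ⟨g₁, hg₁, hgf₁⟩ := hX q hq
  obtain ⟨g₂, hg₂, hgf₂⟩ := hX r hr
  obtain ⟨h₁, hh₁, hhf₁⟩ := hA q hq
  obtain ⟨h₂, hh₂, hhf₂⟩ := hA r hr
  obtain ⟨k, l, hkl, u, hu, huf⟩ := exists_continuousOn_exp_eq_zpow_mul_zpow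
    hWo.isClosed_compl hγ.isClosed_image (hγ.compl_inter_image hWo) hg₁ hg₂ hh₁ hh₂
    hgf₁ hgf₂ hhf₁ hhf₂
  have hfr : ∀ w, frontier (connectedComponentIn O w) ⊆ Wᶜ ∪ γ '' Icc 0 1 := fun w => by
    rw [← compl_compl (Wᶜ ∪ γ '' Icc 0 1), ← hdiff]
    exact hO.frontier_connectedComponentIn_subset_compl w
  have hnot : ∀ {v w}, v ∈ O → v ∉ connectedComponentIn O w →
      v ∉ closure (connectedComponentIn O w) := fun {v w} hv hvw hv' => by
    have : v ∈ frontier (connectedComponentIn O w) := by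
      rw [hO.connectedComponentIn.frontier_eq]
      exact ⟨hv', hvw⟩
    exact hO.frontier_connectedComponentIn_subset_compl w this hv
  have hbdd : ∀ w, Bornology.IsBounded (connectedComponentIn O w) := fun w =>
    hWb.subset ((connectedComponentIn_subset O w).trans sdiff_subset)
  have hK : ∀ w ∈ O, w ∉ Wᶜ ∪ γ '' Icc 0 1 := fun w hw => by
    rwa [hdiff] at hw
  rcases hkl with hk | hl
  · exact hk (eq_zero_of_exp_eq_zpow_mul_zpow hO.connectedComponentIn (hbdd q) (hfr q)
      (mem_connectedComponentIn hq) (hK q hq) (hnot hp hpq) (hnot hr hrq) hu huf)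
  · exact hl (eq_zero_of_exp_eq_zpow_mul_zpow hO.connectedComponentIn (hbdd r) (hfr r)
      (mem_connectedComponentIn hr) (hK r hr) (hnot hp hpr) (hnot hq hqr) hu
      fun z hz => (huf z hz).trans (mul_comm _ _))

/-- A crosscut of a simply connected domain separates it. -/
theorem not_isPreconnected_diff (hWo : IsOpen W) (hWsc : SimplyConnectedSpace W)
    (hγ : IsCrosscut W γ) : ¬ IsPreconnected (W \ γ '' Ioo 0 1) := by
  classical
  intro hpre
  have hends := hγ.compl_inter_image hWo
  have hdiff := hγ.diff_eq hWo
  have hAc := hγ.isClosed_image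
  have hne : γ 0 ≠ γ 1 := fun h => zero_ne_one (hγ.2.1 (by simp) (by simp) h)
  obtain ⟨ha, haA⟩ : γ 0 ∈ Wᶜ ∩ γ '' Icc 0 1 := hends ▸ mem_insert _ _
  obtain ⟨hb, hbA⟩ : γ 1 ∈ Wᶜ ∩ γ '' Icc 0 1 := hends ▸ mem_insert_of_mem _ rfl
  have hjoin : JoinedIn (γ '' Icc 0 1) (γ 0) (γ 1) := by
    refine IsPathConnected.joinedIn ?_ _ haA _ hbA
    exact ((convex_Icc (0 : ℝ) 1).isPathConnected ⟨0, by simp⟩).image' hγ.1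
  set a := γ 0
  set b := γ 1
  set A := γ '' Icc 0 1
  obtain ⟨g₁, hg₁, hgf₁⟩ := JoinedIn.exists_continuousOn_exp_eq (S := Aᶜ)
    (by rwa [compl_compl])
  have hWab : ∀ z ∈ W, z - a ≠ 0 ∧ z - b ≠ 0 := fun z hz =>
    ⟨fun h => ha (sub_eq_zero.1 h ▸ hz), fun h => hb (sub_eq_zero.1 h ▸ hz)⟩
  obtain ⟨g₂, hg₂, hgf₂⟩ := exists_continuousOn_eqOn_exp_comp
    hWsc hWo
    (g := fun z => (z - a) / (z - b))
    (ContinuousOn.div (by fun_prop) (by fun_prop) fun z hz => (hWab z hz).2) (by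
      rintro ⟨z, hz, h⟩
      exact div_ne_zero (hWab z hz).1 (hWab z hz).2 h)
  have hsub₁ : W \ γ '' Ioo 0 1 ⊆ Aᶜ := by
    rw [hdiff]
    exact compl_subset_compl.2 subset_union_right
  obtain ⟨c, hc, hceq⟩ := exists_eqOn_add_const_of_exp_eq hpre (hg₁.mono hsub₁)
    (hg₂.mono sdiff_subset)
    fun z hz => (hgf₁ z (hsub₁ hz)).trans (hgf₂ hz.1).symm
  let G := W.piecewise (fun z => g₂ z + c) g₁
  have hGW : EqOn G (fun z => g₂ z + c) W := fun z hz => piecewise_eq_of_mem _ _ _ hz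
  have hGA : EqOn G g₁ Aᶜ := fun z hz => by
    by_cases hzW : z ∈ W
    · refine (hGW hzW).trans (hceq z ?_).symm
      rw [hdiff]
      rintro (h | h)
      exacts [h hzW, hz h]
    · exact piecewise_eq_of_notMem _ _ _ hzW
  have hGc : ContinuousOn G (W ∪ Aᶜ) :=
    ((hg₂.add continuousOn_const).congr hGW).union_of_isOpen (hg₁.congr hGA) hWo hAc.isOpen_compl
  have hGe : ∀ z ∈ W ∪ Aᶜ, exp (G z) = (z - a) / (z - b) := by
    rintro z (hz | hz)
    · rw [hGW hz, exp_add, hc, mul_one]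
      exact hgf₂ hz
    · rw [hGA hz, hgf₁ z hz]
  have hdist : 0 < dist b a := dist_pos.2 hne.symm
  have hball : closure (Metric.ball a (dist b a / 2)) = Metric.closedBall a (dist b a / 2) :=
    closure_ball a (half_pos hdist).ne'
  have hbne : ∀ z ∈ Metric.closedBall a (dist b a / 2), z - b ≠ 0 := fun z hz h => by
    rw [sub_eq_zero.1 h, Metric.mem_closedBall] at hz
    linarith
  have hsph : Metric.sphere a (dist b a / 2) ⊆ W ∪ Aᶜ := fun z hz => by
    by_contra hcon
    simp only [mem_union, mem_compl_iff, not_or, not_not] at hcon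
    have : z ∈ ({a, b} : Set ℂ) := hends ▸ hcon
    rcases this with rfl | rfl
    · rw [Metric.mem_sphere, dist_self] at hz
      linarith
    · exact hbne _ (Metric.sphere_subset_closedBall hz) (sub_self _)
  have hfr : frontier (Metric.ball a (dist b a / 2)) = Metric.sphere a (dist b a / 2) :=
    frontier_ball a (half_pos hdist).ne'
  refine one_ne_zero (eq_zero_of_exp_mul_eq_zpow_on_frontier (k := 1) Metric.isOpen_ball
    Metric.isBounded_ball (Metric.mem_ball_self (half_pos hdist)) (g := G) (G := fun z => z - b)
    (hfr ▸ hGc.mono hsph) (by fun_prop) (hball ▸ hbne) fun z hz => ?_)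
  rw [hfr] at hz
  rw [hGe z (hsph hz), div_mul_cancel₀ _ (hbne z (Metric.sphere_subset_closedBall hz)), zpow_one]

end IsCrosscut

/-- A crosscut divides a bounded simply connected domain into exactly two
connected components. -/
theorem crosscut_two_components
    (W : Set ℂ) (hWb : Bornology.IsBounded W) (hWo : IsOpen W)
    (hWc : IsConnected W) (hWsc : SimplyConnectedSpace W)
    (γ : ℝ → ℂ) (hγ : IsCrosscut W γ) :
    Nat.card (ConnectedComponents ↥(W \ γ '' Set.Ioo 0 1)) = 2 := by
  have hnot := hγ.not_isPreconnected_diff hWo hWsc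
  have hthree : ∀ p q r : ↥(W \ γ '' Set.Ioo 0 1),
      (p : ConnectedComponents ↥(W \ γ '' Set.Ioo 0 1)) = q ∨
      (p : ConnectedComponents ↥(W \ γ '' Set.Ioo 0 1)) = r ∨
      (q : ConnectedComponents ↥(W \ γ '' Set.Ioo 0 1)) = r := by
    intro p q r
    have h := hγ.connectedComponentIn_eq_of_three hWb hWo hWc p.2 q.2 r.2
    simpa only [connectedComponentIn_eq_image q.2, connectedComponentIn_eq_image r.2,
      Subtype.val_injective.mem_set_image, Subtype.coe_eta,
      ← ConnectedComponents.coe_eq_coe'] using h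
  obtain ⟨x, y, hxy⟩ : ∃ x y : ConnectedComponents ↥(W \ γ '' Set.Ioo 0 1), x ≠ y := by
    by_contra! hall
    refine hnot (isPreconnected_iff_preconnectedSpace.2 ?_)
    refine preconnectedSpace_iff_connectedComponent.2 fun x => Set.eq_univ_of_forall fun y => ?_
    exact ConnectedComponents.coe_eq_coe'.1 (hall y x)
  refine Nat.card_eq_two_iff.2 ⟨x, y, hxy, Set.eq_univ_of_forall fun z => ?_⟩
  obtain ⟨p, rfl⟩ := ConnectedComponents.surjective_coe x
  obtain ⟨q, rfl⟩ := ConnectedComponents.surjective_coe y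
  obtain ⟨r, rfl⟩ := ConnectedComponents.surjective_coe z
  rcases hthree p q r with h | h | h
  · exact absurd h hxy
  · exact Or.inl h.symm
  · exact Or.inr h.symm
end

section
/- Let X ⊆ ℝ² be a compact connected set and let m : (0,a) → ℝ be a modulus of local connectivity for X. If x, y ∈ X satisfy dist(x,y) < r < a, then there exists a continuous path ℓ : [0,1] → X with ℓ(0) = x, ℓ(1) = y, and diam ℓ([0,1]) ≤ m(r). -/
/-- Points of a preconnected set are joined inside it by finite chains of arbitrarily small mesh. -/
theorem IsPreconnected.exists_chain {E : Type*} [PseudoMetricSpace E] {L : Set E}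
    (hL : IsPreconnected L) {δ : ℝ} (hδ : 0 < δ) {p q : E} (hp : p ∈ L) (hq : q ∈ L) :
    ∃ (N : ℕ) (c : ℕ → E), c 0 = p ∧ (∀ j, N ≤ j → c j = q) ∧ (∀ j, c j ∈ L) ∧
      ∀ j, dist (c j) (c (j + 1)) < δ := by
  have key : Relation.ReflTransGen (fun u v => u ∈ L ∧ v ∈ L ∧ dist u v < δ) p q := by
    refine hL.induction₂ _ (fun u hu => ?_) (fun _ _ _ _ _ _ h h' => h.trans h') ?_ hp hq
    · filter_upwards [self_mem_nhdsWithin, mem_nhdsWithin_of_mem_nhds (Metric.ball_mem_nhds u hδ)]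
        with v hv hv'
      exact .single ⟨hu, hv, by simpa [dist_comm] using hv'⟩
    · intro u v _ _ h
      have : Std.Symm (fun u v => u ∈ L ∧ v ∈ L ∧ dist u v < δ) :=
        ⟨fun u v h => ⟨h.2.1, h.1, by rw [dist_comm]; exact h.2.2⟩⟩
      exact symm h
  clear hq
  induction key using Relation.ReflTransGen.head_induction_on with
  | refl => exact ⟨0, fun _ => q, rfl, fun _ _ => rfl, fun _ => hp, fun _ => by simpa⟩
  | @head u v h _ ih =>
    obtain ⟨N, c, h0, hN, hc, hd⟩ := ih h.2.1
    refine ⟨N + 1, fun j => Nat.casesOn j u c, rfl, ?_, ?_, ?_⟩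
    · rintro (_ | j) hj
      · omega
      · exact hN j (by omega)
    · rintro (_ | j)
      · exact h.1
      · exact hc j
    · rintro (_ | j)
      · simpa [h0] using h.2.2
      · exact hd j

/-- A chain from `x` to `y` of mesh less than `δ` can be refined to one of mesh less than `δ'`,
each link being replaced by the same number of points, all close to its starting point. -/
theorem exists_chain_refinement {E : Type*} [PseudoMetricSpace E] {δ ε δ' : ℝ}
    (hε : 0 < ε) (hδ' : 0 < δ')
    (hconn : ∀ x y : E, dist x y < δ →
      ∃ L : Set E, IsPreconnected L ∧ x ∈ L ∧ y ∈ L ∧ L ⊆ Metric.ball x ε)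
    {u : ℕ → E} {y : E} {M : ℕ} (hM : ∀ j, M ≤ j → u j = y)
    (hu : ∀ j, dist (u j) (u (j + 1)) < δ) :
    ∃ (K : ℕ) (v : ℕ → E), 0 < K ∧ v 0 = u 0 ∧ (∀ j, M * K ≤ j → v j = y) ∧
      (∀ j, dist (v j) (v (j + 1)) < δ') ∧ ∀ j, dist (u (j / K)) (v j) < ε := by
  have h1 : ∀ i, ∃ (N : ℕ) (c : ℕ → E), c 0 = u i ∧ (∀ j, N ≤ j → c j = u (i + 1)) ∧
      (∀ j, dist (u i) (c j) < ε) ∧ ∀ j, dist (c j) (c (j + 1)) < δ' := by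
    intro i
    obtain ⟨L, hL, h1, h2, h3⟩ := hconn _ _ (hu i)
    obtain ⟨N, c, h0, hN, hc, hd⟩ := hL.exists_chain hδ' h1 h2
    exact ⟨N, c, h0, hN, fun j => by simpa [dist_comm] using h3 (hc j), hd⟩
  choose N c h0 hN hc hd using h1
  set K := (Finset.range M).sup N + 1 with hK
  have h2 : ∀ i, ∃ c : ℕ → E, c 0 = u i ∧ c K = u (i + 1) ∧ (M ≤ i → ∀ j, c j = y) ∧
      (∀ j, dist (u i) (c j) < ε) ∧ ∀ j, dist (c j) (c (j + 1)) < δ' := by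
    intro i
    by_cases hi : i < M
    · refine ⟨c i, h0 i, hN i K ?_, fun h => by omega, hc i, hd i⟩
      have := Finset.le_sup (f := N) (Finset.mem_range.2 hi)
      omega
    · push Not at hi
      exact ⟨fun _ => y, (hM i hi).symm, (hM _ (by omega)).symm, fun _ _ => rfl,
        fun _ => by simpa [hM i hi], fun _ => by simpa⟩
  clear_value K
  have hKpos : 0 < K := by omega
  choose w w0 wK wM we wd using h2
  refine ⟨K, fun k => w (k / K) (k % K), hKpos, by simp [w0], ?_, ?_, fun k => we _ _⟩
  · intro j hj
    exact wM _ ((Nat.le_div_iff_mul_le hKpos).2 hj) _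
  · intro k
    have hmod := Nat.mod_lt k hKpos
    have hdm := Nat.div_add_mod k K
    rcases Nat.lt_or_ge (k % K + 1) K with h | h
    · have e : k + 1 = (k % K + 1) + K * (k / K) := by omega
      have e1 : (k + 1) / K = k / K := by
        rw [e, Nat.add_mul_div_left _ _ hKpos, Nat.div_eq_of_lt h, zero_add]
      have e2 : (k + 1) % K = k % K + 1 := by
        rw [e, Nat.add_mul_mod_self_left, Nat.mod_eq_of_lt h]
      simp only [e1, e2]
      exact wd _ _
    · have e : k + 1 = K * (k / K + 1) := by rw [mul_add, mul_one]; omega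
      have e1 : (k + 1) / K = k / K + 1 := by rw [e, Nat.mul_div_cancel_left _ hKpos]
      have e2 : (k + 1) % K = 0 := by rw [e, Nat.mul_mod_right]
      have e3 : k % K + 1 = K := by omega
      have := wd (k / K) (k % K)
      rw [e3, wK] at this
      simpa only [e1, e2, w0] using this

/-- Evaluating a chain at `⌊M t⌋₊` moves points by less than the mesh when `M |s - t| < 1`. -/
theorem dist_chain_floor_lt {E : Type*} [PseudoMetricSpace E] {δ : ℝ} {u : ℕ → E}
    (hu : ∀ j, dist (u j) (u (j + 1)) < δ) {M : ℝ} (hM : 0 < M) {s t : ℝ}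
    (hst : M * |s - t| < 1) : dist (u ⌊M * s⌋₊) (u ⌊M * t⌋₊) < δ := by
  wlog h : s ≤ t generalizing s t
  · rw [dist_comm]
    exact this (by rwa [abs_sub_comm]) (le_of_not_ge h)
  have h1 : ⌊M * s⌋₊ ≤ ⌊M * t⌋₊ := Nat.floor_mono (by gcongr)
  have h2 : ⌊M * t⌋₊ ≤ ⌊M * s⌋₊ + 1 := by
    rw [abs_sub_comm, abs_of_nonneg (by linarith)] at hst
    rcases Nat.eq_zero_or_pos ⌊M * t⌋₊ with h0 | h0
    · omega
    · have hf := Nat.floor_le (Nat.pos_of_floor_pos h0).le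
      have := Nat.lt_floor_add_one (M * s)
      have : (⌊M * t⌋₊ : ℝ) < ((⌊M * s⌋₊ + 2 : ℕ) : ℝ) := by
        push_cast
        nlinarith
      have := Nat.cast_lt.1 this
      omega
  rcases (by omega : ⌊M * t⌋₊ = ⌊M * s⌋₊ ∨ ⌊M * t⌋₊ = ⌊M * s⌋₊ + 1) with e | e
  · rw [e, dist_self]
    exact dist_nonneg.trans_lt (hu 0)
  · rw [e]
    exact hu _

/-- In a complete metric space in which nearby points lie in small connected sets, nearby points
are joined by small paths. -/
theorem exists_joinedIn_ball_of_small_preconnected {E : Type*} [MetricSpace E] [CompleteSpace E]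
    (hconn : ∀ ε > 0, ∃ δ > 0, ∀ x y : E, dist x y < δ →
      ∃ L : Set E, IsPreconnected L ∧ x ∈ L ∧ y ∈ L ∧ L ⊆ Metric.ball x ε)
    {ε : ℝ} (hε : 0 < ε) :
    ∃ δ > 0, ∀ x y : E, dist x y < δ → JoinedIn (Metric.ball x ε) x y := by
  set C := ε / 3 with hC
  have hCpos : 0 < C := by positivity
  have hCn : ∀ n : ℕ, 0 < C / 2 / 2 ^ n := fun n => by positivity
  have : ∀ n : ℕ, ∃ δ > 0, δ ≤ C / 2 / 2 ^ n ∧ ∀ x y : E, dist x y < δ →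
      ∃ L : Set E, IsPreconnected L ∧ x ∈ L ∧ y ∈ L ∧ L ⊆ Metric.ball x (C / 2 / 2 ^ n) := by
    intro n
    obtain ⟨δ, hδ, h⟩ := hconn _ (hCn n)
    exact ⟨min δ (C / 2 / 2 ^ n), lt_min hδ (hCn n), min_le_right _ _,
      fun x y hxy => h x y (hxy.trans_le (min_le_left _ _))⟩
  choose δ hδ hδC hδL using this
  refine ⟨δ 0, hδ 0, fun x y hxy => ?_⟩
  let Good : ℕ → ℕ × (ℕ → E) → Prop := fun n p =>
    0 < p.1 ∧ p.2 0 = x ∧ (∀ j, p.1 ≤ j → p.2 j = y) ∧ ∀ j, dist (p.2 j) (p.2 (j + 1)) < δ n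
  have hstep : ∀ n (p : {p // Good n p}), ∃ q : {q // Good (n + 1) q}, ∃ K : ℕ, 0 < K ∧
      q.1.1 = p.1.1 * K ∧ ∀ j, dist (p.1.2 (j / K)) (q.1.2 j) < C / 2 / 2 ^ n := by
    rintro n ⟨⟨M, u⟩, hM, hu0, huM, hud⟩
    obtain ⟨K, v, hK, v0, vM, vd, ve⟩ :=
      exists_chain_refinement (hCn n) (hδ (n + 1)) (hδL n) huM hud
    exact ⟨⟨(M * K, v), by positivity, v0.trans hu0, vM, vd⟩, K, hK, rfl, ve⟩
  choose next K hK hnext hdist using hstep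
  have hbase : Good 0 (1, fun j => if j = 0 then x else y) := by
    refine ⟨one_pos, rfl, fun j hj => if_neg (by omega), ?_⟩
    rintro (_ | j)
    · simpa using hxy
    · simpa using hδ 0
  let P : ∀ n, {p // Good n p} := fun n => Nat.rec ⟨_, hbase⟩ next n
  let f : ℕ → ℝ → E := fun n t => (P n).1.2 ⌊((P n).1.1 : ℝ) * t⌋₊
  have hf : ∀ t n, dist (f n t) (f (n + 1) t) ≤ C / 2 / 2 ^ n := by
    intro t n
    have h1 := hdist n (P n) ⌊((P (n + 1)).1.1 : ℝ) * t⌋₊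
    have e : ⌊((P (n + 1)).1.1 : ℝ) * t⌋₊ / K n (P n) = ⌊((P n).1.1 : ℝ) * t⌋₊ := by
      have hK' : (K n (P n) : ℝ) ≠ 0 := by exact_mod_cast (hK n (P n)).ne'
      rw [← Nat.floor_div_natCast, show (P (n + 1)).1.1 = (P n).1.1 * K n (P n) from hnext n (P n)]
      congr 1
      push_cast
      field_simp
    rw [e] at h1
    exact h1.le
  choose g hg using fun t => cauchySeq_tendsto_of_complete (cauchySeq_of_le_geometric_two (hf t))
  have hfg : ∀ n t, dist (f n t) (g t) ≤ C / 2 ^ n := fun n t =>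
    dist_le_of_le_geometric_two_of_tendsto (hf t) (hg t) n
  have hcont : Continuous g := by
    rw [Metric.continuous_iff]
    intro t η hη
    obtain ⟨n, hn⟩ : ∃ n : ℕ, C / 2 ^ n < η / 3 := by
      obtain ⟨n, hn⟩ := exists_pow_lt_of_lt_one (y := (1 / 2 : ℝ))
        (show 0 < η / 3 / C by positivity) (by norm_num)
      refine ⟨n, ?_⟩
      rw [lt_div_iff₀ hCpos] at hn
      calc C / 2 ^ n = (1 / 2) ^ n * C := by rw [div_pow, one_pow]; ring
        _ < _ := hn
    have hM : 0 < ((P n).1.1 : ℝ) := by exact_mod_cast (P n).2.1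
    refine ⟨1 / ((P n).1.1 : ℝ), by positivity, fun s hs => ?_⟩
    have h1 : dist (f n s) (f n t) < δ n := by
      refine dist_chain_floor_lt (P n).2.2.2.2 hM ?_
      rw [Real.dist_eq, lt_div_iff₀ hM] at hs
      linarith
    have h2 : C / 2 / 2 ^ n ≤ C / 2 ^ n := by gcongr; linarith
    have h3 := hfg n s
    have h4 := hfg n t
    have h5 := dist_triangle4 (g s) (f n s) (f n t) (g t)
    rw [dist_comm (g s) (f n s)] at h5
    linarith [hδC n]
  have hg0 : g 0 = x := tendsto_nhds_unique (hg 0) <| by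
    have : ∀ n, f n 0 = x := fun n => by simpa [f] using (P n).2.2.1
    simp [this]
  have hg1 : g 1 = y := tendsto_nhds_unique (hg 1) <| by
    have : ∀ n, f n 1 = y := fun n => by simpa [f] using (P n).2.2.2.1 _ le_rfl
    simp [this]
  refine JoinedIn.ofLine hcont.continuousOn hg0 hg1 ?_
  rintro _ ⟨t, -, rfl⟩
  have h1 : dist (f 0 t) x < δ 0 := by
    change dist (if ⌊((1 : ℕ) : ℝ) * t⌋₊ = 0 then x else y) x < δ 0
    split_ifs
    · simpa using hδ 0
    · rwa [dist_comm]
  have h2 := hfg 0 t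
  have h3 := hδC 0
  have h4 := dist_triangle_left (g t) x (f 0 t)
  simp only [pow_zero, div_one] at h2 h3
  rw [Metric.mem_ball]
  linarith

/-- A complete metric space in which nearby points lie in small connected sets is locally path
connected. -/
theorem locallyPathConnectedSpace_of_small_preconnected {E : Type*} [MetricSpace E]
    [CompleteSpace E]
    (hconn : ∀ ε > 0, ∃ δ > 0, ∀ x y : E, dist x y < δ →
      ∃ L : Set E, IsPreconnected L ∧ x ∈ L ∧ y ∈ L ∧ L ⊆ Metric.ball x ε) :
    LocallyPathConnectedSpace E := by
  refine .of_bases (p := fun _ ε => (0 : ℝ) < ε)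
    (s := fun x ε => pathComponentIn (Metric.ball x ε) x) (fun x => ?_) fun x ε hε =>
      isPathConnected_pathComponentIn (Metric.mem_ball_self hε)
  refine Metric.nhds_basis_ball.to_hasBasis (fun ε hε => ⟨ε, hε, pathComponentIn_subset⟩)
    fun ε hε => ?_
  obtain ⟨δ, hδ, h⟩ := exists_joinedIn_ball_of_small_preconnected hconn hε
  exact ⟨δ, hδ, fun y hy => h x y (by simpa [dist_comm] using hy)⟩


/-- A modulus of local connectivity is also a modulus of path connectivity:
if `dist x y < r < a` then `x, y` are joined by a path in `X` of diameter `≤ m r`. -/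
theorem path_of_modulus_of_local_connectivity
    (X : Set (EuclideanSpace ℝ (Fin 2))) (hXcomp : IsCompact X) (hXconn : IsConnected X)
    (a : ℝ) (m : ℝ → ℝ)
    (hmono : StrictMonoOn m (Set.Ioo 0 a))
    (hmod : ∀ x ∈ X, ∀ y ∈ X, ∀ r : ℝ, dist x y < r → r < a →
      ∃ L : Set (EuclideanSpace ℝ (Fin 2)), L ⊆ X ∧ IsConnected L ∧ x ∈ L ∧ y ∈ L ∧
        Metric.diam L < m r)
    (hlim : Filter.Tendsto m (nhdsWithin 0 (Set.Ioi 0)) (nhds 0))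
    (x y : EuclideanSpace ℝ (Fin 2)) (hx : x ∈ X) (hy : y ∈ X)
    (r : ℝ) (hr : dist x y < r) (hra : r < a) :
    ∃ ℓ : ℝ → EuclideanSpace ℝ (Fin 2), ContinuousOn ℓ (Set.Icc 0 1) ∧
      ℓ '' Set.Icc 0 1 ⊆ X ∧ ℓ 0 = x ∧ ℓ 1 = y ∧
      Metric.diam (ℓ '' Set.Icc 0 1) ≤ m r := by
  have hr0 : 0 < r := dist_nonneg.trans_lt hr
  have : CompactSpace X := isCompact_iff_compactSpace.1 hXcomp
  have hLPC : LocallyPathConnectedSpace X := by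
    refine locallyPathConnectedSpace_of_small_preconnected fun ε hε => ?_
    obtain ⟨s, ⟨hs, hsa⟩, hs0⟩ :=
      ((hlim.eventually_lt_const hε).and
        (mem_nhdsWithin_of_mem_nhds (Iio_mem_nhds (hr0.trans hra))) |>.and
        self_mem_nhdsWithin).exists
    refine ⟨s, hs0, fun p q hpq => ?_⟩
    obtain ⟨L, hLX, hL, hp, hq, hd⟩ := hmod p p.2 q q.2 s hpq hsa
    refine ⟨Subtype.val ⁻¹' L, ?_, hp, hq, fun z hz => ?_⟩
    · rw [← Topology.IsInducing.subtypeVal.isPreconnected_image,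
        Subtype.image_preimage_coe, Set.inter_eq_right.2 hLX]
      exact hL.isPreconnected
    · exact (Metric.dist_le_diam_of_mem (hXcomp.isBounded.subset hLX) hz hp).trans_lt
        (hd.trans hs)
  obtain ⟨L, hLX, hL, hxL, hyL, hd⟩ := hmod x hx y hy r hr hra
  set ε := (m r - Metric.diam L) / 2 with hε
  have hεpos : 0 < ε := by linarith
  set U : Set X := Subtype.val ⁻¹' Metric.thickening ε L
  have hU : IsOpen U := Metric.isOpen_thickening.preimage continuous_subtype_val
  have hLU : Subtype.val ⁻¹' L ⊆ U := Set.preimage_mono (Metric.self_subset_thickening hεpos L)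
  have hLc : IsPreconnected (Subtype.val ⁻¹' L : Set X) := by
    rw [← Topology.IsInducing.subtypeVal.isPreconnected_image,
      Subtype.image_preimage_coe, Set.inter_eq_right.2 hLX]
    exact hL.isPreconnected
  have hsub := hLc.subset_connectedComponentIn (x := ⟨x, hx⟩) hxL hLU
  have hpc : IsPathConnected (connectedComponentIn U ⟨x, hx⟩) :=
    (hU.connectedComponentIn).isConnected_iff_isPathConnected.1
      (isConnected_connectedComponentIn_iff.2 (hLU hxL))
  obtain ⟨γ, hγ⟩ := hpc.joinedIn ⟨x, hx⟩ (hsub hxL) ⟨y, hy⟩ (hsub hyL)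
  have himg : (fun t => (γ.extend t : EuclideanSpace ℝ (Fin 2))) '' Set.Icc 0 1 ⊆
      Metric.thickening ε L := by
    rintro _ ⟨t, ht, rfl⟩
    simp only [γ.extend_apply ht]
    exact connectedComponentIn_subset U _ (hγ ⟨t, ht⟩)
  refine ⟨fun t => γ.extend t, by fun_prop, ?_, by simp, by simp, ?_⟩
  · rintro _ ⟨t, -, rfl⟩
    exact (γ.extend t).2
  · have h1 := Metric.diam_mono himg (hXcomp.isBounded.subset hLX).thickening
    have h2 := Metric.diam_thickening_le L hεpos.le
    linarith
end
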